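/- arXiv:2309.08306 — 2 statements merged into one kernel-verified Lean document; each statement's English description precedes it below -/
import Mathlib

section
/- In H²(ℂ₊), the closed subspace N(1/(1+s)) spanned by {e^{−λs}/(1+s) : 0 ≤ λ ≤ δ} is invariant under the adjoint multiplication semigroup (backward shift) and equals the model space K_θ with θ(s) = ((1−s)/(1+s))·e^{−δs}. -/
open MeasureTheory Complex Filter

noncomputable section

/-- Boundary `L²` space of the right half-plane: `L²(iℝ)` parametrized by `y ∈ ℝ`. -/
abbrev L2R := MeasureTheory.Lp ℂ 2 (volume : Measure ℝ)

/-- The Hardy space `H²(ℂ₊)` (boundary values): the closed span of the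
reproducing kernels `s ↦ 1/(s + w̄)`, `Re w > 0`, evaluated at `s = iy`. -/
def Hplus : Submodule ℂ L2R :=
  (Submodule.span ℂ {f : L2R | ∃ w : ℂ, 0 < w.re ∧
    (f : ℝ → ℂ) =ᵐ[volume] fun y : ℝ => (Complex.I * y + (starRingEnd ℂ) w)⁻¹}).topologicalClosure

/-- The model space `K_θ = H²(ℂ₊) ⊖ θ H²(ℂ₊)`, for a boundary symbol `θ`. -/
def KmodP (θ : ℝ → ℂ) : Set L2R :=
  {f | f ∈ Hplus ∧ ∀ h : L2R, h ∈ Hplus →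
    ∫ y : ℝ, (starRingEnd ℂ) (θ y * h y) * f y = 0}

/-- `N(g)`: the closed span of `{g e^{-λ s} : 0 ≤ λ ≤ δ}` in `H²(ℂ₊)` (boundary model,
`s = iy`). -/
def NspanP (δ : ℝ) (g : ℝ → ℂ) : Set L2R :=
  SetLike.coe (Submodule.span ℂ {f : L2R | ∃ lam : ℝ, 0 ≤ lam ∧ lam ≤ δ ∧
    (f : ℝ → ℂ) =ᵐ[volume]
      fun y : ℝ => g y * Complex.exp (-(lam : ℂ) * (Complex.I * y))}).topologicalClosure

/-- `N` is invariant under the adjoint multiplication semigroup `{M(t)^*}_{t ≥ 0}`: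
for each `f ∈ N` and `t ≥ 0`, the projection of `e^{ts} f` onto `H²` lies in `N`. -/
def BwdInvP (N : Set L2R) : Prop :=
  ∀ t : ℝ, 0 ≤ t → ∀ f ∈ N, ∃ n ∈ N, ∀ h : L2R, h ∈ Hplus →
    ∫ y : ℝ, (starRingEnd ℂ) (h y) *
      (Complex.exp ((t : ℂ) * (Complex.I * y)) * f y - n y) = 0


open scoped FourierTransform ComplexConjugate InnerProductSpace

/-- The Fourier transform is injective on `L¹(ℝ)`. -/
theorem ae_eq_zero_of_forall_integral_exp_mul_eq_zero {φ : ℝ → ℂ} (hφ : Integrable φ)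
    (h : ∀ l : ℝ, ∫ y : ℝ, Complex.exp (l * (I * y)) * φ y = 0) : φ =ᵐ[volume] 0 := by
  have hF : 𝓕 φ = 0 := by
    ext w
    rw [Real.fourier_real_eq_integral_exp_smul]
    simp only [Pi.zero_apply]
    rw [← h (-2 * Real.pi * w)]
    congr with y
    simp only [smul_eq_mul]
    congr 2
    push_cast
    ring
  refine ae_eq_zero_of_integral_contDiff_smul_eq_zero hφ.locallyIntegrable fun g hg hgc => ?_
  have hc : HasCompactSupport (fun x => (g x : ℂ)) := hgc.comp_left (g := fun x : ℝ => (x : ℂ)) rfl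
  have hd : ContDiff ℝ (⊤ : ℕ∞) (fun x => (g x : ℂ)) := Complex.ofRealCLM.contDiff.comp hg
  set G : SchwartzMap ℝ ℂ := hc.toSchwartzMap hd
  have key := VectorFourier.integral_fourierIntegral_smul_eq_flip (L := innerₗ ℝ)
    (μ := volume) (ν := volume) (f := φ) (g := (𝓕⁻ G : SchwartzMap ℝ ℂ))
    Real.continuous_fourierChar continuous_inner hφ (SchwartzMap.integrable _)
  have h1 : VectorFourier.fourierIntegral Real.fourierChar volume (innerₗ ℝ) φ = 0 := hF
  have h2 : VectorFourier.fourierIntegral Real.fourierChar volume (innerₗ ℝ).flip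
      (𝓕⁻ G : SchwartzMap ℝ ℂ) = fun x => (g x : ℂ) := by
    rw [flip_innerₗ]
    change 𝓕 ((𝓕⁻ G : SchwartzMap ℝ ℂ) : ℝ → ℂ) = _
    rw [← SchwartzMap.fourier_coe, FourierTransform.fourier_fourierInv_eq]
    rfl
  rw [h1, h2] at key
  simp only [Pi.zero_apply, zero_smul, integral_zero] at key
  rw [key]
  congr with x
  simp [mul_comm]

theorem integral_exp_mul_fourier_eq {u U : ℝ → ℂ} (hu : Continuous u) (hui : Integrable u)
    (hU : Integrable U) (h : ∀ y : ℝ, ∫ t : ℝ, Complex.exp (-t * (I * y)) * u t = U y) (t : ℝ) :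
    ∫ y : ℝ, Complex.exp (t * (I * y)) * U y = 2 * Real.pi * u t := by
  have hF : 𝓕 u = fun w => U (2 * Real.pi * w) := by
    ext w
    rw [Real.fourier_real_eq_integral_exp_smul, ← h]
    congr with v
    simp only [smul_eq_mul]
    congr 2
    push_cast
    ring
  have hpi : (2 * Real.pi) ≠ 0 := by positivity
  have hinv := congrFun (hu.fourierInv_fourier_eq hui (by
    rw [hF]; exact hU.comp_mul_left' hpi)) t
  rw [hF, Real.fourierInv_eq'] at hinv
  have := Measure.integral_comp_mul_left
    (fun y : ℝ => Complex.exp (t * (I * y)) * U y) (2 * Real.pi)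
  rw [← hinv]
  have e : ∀ v : ℝ, Complex.exp (((2 * Real.pi * inner ℝ v t : ℝ) : ℂ) * I) •
      U (2 * Real.pi * v) = Complex.exp (t * (I * ((2 * Real.pi * v : ℝ) : ℂ))) *
      U (2 * Real.pi * v) := by
    intro v
    simp only [smul_eq_mul]
    congr 2
    simp
    ring
  simp_rw [e]
  rw [this, abs_of_pos (by positivity), Complex.real_smul]
  push_cast
  field_simp

theorem integral_mul_integral_exp_swap {ψ κ : ℝ → ℂ} (hψ : Integrable ψ) (hκ : Integrable κ) :
    ∫ y : ℝ, ψ y * ∫ t : ℝ, κ t * Complex.exp (-t * (I * y)) =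
      ∫ t : ℝ, κ t * ∫ y : ℝ, ψ y * Complex.exp (-t * (I * y)) := by
  simp_rw [← integral_const_mul]
  rw [integral_integral_swap]
  · congr with t
    congr with y
    ring
  · have h := (hψ.mul_prod hκ).mul_bdd (c := 1)
      (g := fun p : ℝ × ℝ => Complex.exp (-p.2 * (I * p.1)))
      (by apply Continuous.aestronglyMeasurable; fun_prop)
      (by
        refine Eventually.of_forall fun p => le_of_eq ?_
        rw [Complex.norm_exp]; simp)
    refine h.congr (Eventually.of_forall fun p => ?_)
    simp [Function.uncurry, mul_assoc]

theorem add_I_mul_ofReal_ne_zero {p : ℂ} (hp : 0 < p.re) (y : ℝ) : p + I * y ≠ 0 := by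
  intro h
  have := congrArg Complex.re h
  simp at this
  linarith

theorem sub_I_mul_ofReal_ne_zero {p : ℂ} (hp : 0 < p.re) (y : ℝ) : p - I * y ≠ 0 := by
  simpa [sub_eq_add_neg] using add_I_mul_ofReal_ne_zero hp (-y)

theorem memLp_inv_add_I_mul {p : ℂ} (hp : 0 < p.re) :
    MemLp (fun y : ℝ => (p + I * y)⁻¹) 2 := by
  have hc : Continuous fun y : ℝ => (p + I * y)⁻¹ :=
    Continuous.inv₀ (by fun_prop) (add_I_mul_ofReal_ne_zero hp)
  rw [memLp_two_iff_integrable_sq_norm hc.aestronglyMeasurable]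
  have h := ((integrable_inv_one_add_sq.comp_div hp.ne').comp_add_right p.im).const_mul
    ((p.re ^ 2)⁻¹)
  refine h.congr (Eventually.of_forall fun y => ?_)
  have h2 : ‖p + I * y‖ ^ 2 = p.re ^ 2 + (y + p.im) ^ 2 := by
    rw [← Complex.normSq_eq_norm_sq, Complex.normSq_apply]
    simp
    ring
  simp only [norm_inv, inv_pow, h2]
  rw [← mul_inv]
  congr 1
  field_simp

theorem memLp_inv_sub_I_mul {p : ℂ} (hp : 0 < p.re) :
    MemLp (fun y : ℝ => (p - I * y)⁻¹) 2 := by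
  have h := (memLp_inv_add_I_mul (p := conj p) (by simpa using hp)).star
  refine h.ae_eq (Eventually.of_forall fun y => ?_)
  simp [sub_eq_add_neg]

theorem integrableOn_exp_mul_Iic_zero {a : ℂ} (ha : 0 < a.re) (y : ℝ) :
    IntegrableOn (fun t : ℝ => Complex.exp (-t * (I * y)) * Complex.exp (a * t)) (Set.Iic 0) := by
  refine (integrableOn_exp_mul_complex_Iic (a := a - I * y) (by simpa using ha) 0).congr_fun
    (fun t _ => ?_) measurableSet_Iic
  simp only [← Complex.exp_add]
  ring_nf

theorem integral_exp_mul_Iic_zero {a : ℂ} (ha : 0 < a.re) (y : ℝ) :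
    ∫ t : ℝ in Set.Iic 0, Complex.exp (-t * (I * y)) * Complex.exp (a * t) = (a - I * y)⁻¹ := by
  have h := integral_exp_mul_complex_Iic (a := a - I * y) (by simpa using ha) 0
  simp only [ofReal_zero, mul_zero, Complex.exp_zero, one_div] at h
  rw [← h]
  congr with t
  rw [← Complex.exp_add]
  ring_nf

theorem integrableOn_exp_neg_mul_Ioi_zero {a : ℂ} (ha : 0 < a.re) (y : ℝ) :
    IntegrableOn (fun t : ℝ => Complex.exp (-t * (I * y)) * Complex.exp (-a * t))
      (Set.Ioi 0) := by
  refine (integrableOn_exp_mul_complex_Ioi (a := -a - I * y) (by simpa using ha) 0).congr_fun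
    (fun t _ => ?_) measurableSet_Ioi
  simp only [← Complex.exp_add]
  ring_nf

theorem integral_exp_neg_mul_Ioi_zero {a : ℂ} (ha : 0 < a.re) (y : ℝ) :
    ∫ t : ℝ in Set.Ioi 0, Complex.exp (-t * (I * y)) * Complex.exp (-a * t) = (a + I * y)⁻¹ := by
  have h := integral_exp_mul_complex_Ioi (a := -a - I * y) (by simpa using ha) 0
  simp only [ofReal_zero, mul_zero, Complex.exp_zero] at h
  have h2 : (-1 : ℂ) / (-a - I * y) = (a + I * y)⁻¹ := by
    rw [show (-a - I * y) = -(a + I * y) by ring, neg_div_neg_eq, one_div]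
  rw [← h2, ← h]
  congr with t
  rw [← Complex.exp_add]
  ring_nf

theorem integrable_of_Iic_Ioi {f : ℝ → ℂ} (h1 : IntegrableOn f (Set.Iic 0))
    (h2 : IntegrableOn f (Set.Ioi 0)) : Integrable f := by
  rw [← integrableOn_univ, ← Set.Iic_union_Ioi (a := (0 : ℝ))]
  exact h1.union h2

theorem integral_exp_mul_inv_add_mul_inv_sub {w : ℂ} (hw : 0 < w.re) {t : ℝ} (ht : 0 ≤ t) :
    ∫ y : ℝ, Complex.exp (t * (I * y)) * ((1 + I * y)⁻¹ * (w - I * y)⁻¹) =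
      2 * Real.pi * ((1 + w)⁻¹ * Complex.exp (-t)) := by
  set u : ℝ → ℂ := fun t => (1 + w)⁻¹ *
    (Complex.exp (-(1 : ℂ) * (max t 0 : ℝ)) * Complex.exp (w * (min t 0 : ℝ))) with hu
  have hone : 0 < (1 : ℂ).re := by simp
  have h1w : 1 + w ≠ 0 := by simpa using add_I_mul_ofReal_ne_zero (p := 1 + w) (by simp; linarith) 0
  have hI : ∀ y : ℝ, ∀ t ∈ Set.Iic (0 : ℝ), (1 + w)⁻¹ *
      (Complex.exp (-t * (I * y)) * Complex.exp (w * t)) = Complex.exp (-t * (I * y)) * u t := by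
    intro y t ht
    have ht : t ≤ 0 := ht
    simp only [hu, max_eq_right ht, min_eq_left ht]
    simp
    ring
  have hJ : ∀ y : ℝ, ∀ t ∈ Set.Ioi (0 : ℝ), (1 + w)⁻¹ *
      (Complex.exp (-t * (I * y)) * Complex.exp (-(1 : ℂ) * t)) =
      Complex.exp (-t * (I * y)) * u t := by
    intro y t ht
    have ht : 0 ≤ t := le_of_lt ht
    simp only [hu, max_eq_left ht, min_eq_right ht]
    simp
    ring
  have i1 := fun y => IntegrableOn.congr_fun
    ((integrableOn_exp_mul_Iic_zero hw y).const_mul (1 + w)⁻¹) (hI y) measurableSet_Iic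
  have i2 := fun y => IntegrableOn.congr_fun
    ((integrableOn_exp_neg_mul_Ioi_zero hone y).const_mul (1 + w)⁻¹) (hJ y) measurableSet_Ioi
  have hcont : Continuous u := by fun_prop
  have hint : Integrable u := by
    simpa using integrable_of_Iic_Ioi (i1 0) (i2 0)
  have hU : Integrable fun y : ℝ => (1 + I * y)⁻¹ * (w - I * y)⁻¹ :=
    (memLp_inv_add_I_mul hone).integrable_mul (memLp_inv_sub_I_mul hw)
  rw [integral_exp_mul_fourier_eq hcont hint hU]
  · simp [hu, max_eq_left ht, min_eq_right ht]
  · intro y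
    rw [← intervalIntegral.integral_Iic_add_Ioi (i1 y) (i2 y),
      ← setIntegral_congr_fun measurableSet_Iic (hI y),
      ← setIntegral_congr_fun measurableSet_Ioi (hJ y), integral_const_mul, integral_const_mul,
      integral_exp_mul_Iic_zero hw, integral_exp_neg_mul_Ioi_zero hone]
    have := add_I_mul_ofReal_ne_zero hone y
    have := sub_I_mul_ofReal_ne_zero hw y
    field_simp
    ring

theorem integral_exp_mul_inv_sub_mul_inv_sub_of_ne {w : ℂ} (hw : 0 < w.re) (hw1 : w ≠ 1)
    {t : ℝ} (ht : 0 ≤ t) :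
    ∫ y : ℝ, Complex.exp (t * (I * y)) * ((1 - I * y)⁻¹ * (w - I * y)⁻¹) = 0 := by
  set u : ℝ → ℂ := fun t => (w - 1)⁻¹ *
    (Complex.exp ((1 : ℂ) * (min t 0 : ℝ)) - Complex.exp (w * (min t 0 : ℝ))) with hu
  have hone : 0 < (1 : ℂ).re := by simp
  have h1w : w - 1 ≠ 0 := sub_ne_zero.2 hw1
  have hI : ∀ y : ℝ, ∀ t ∈ Set.Iic (0 : ℝ), (w - 1)⁻¹ *
      (Complex.exp (-t * (I * y)) * Complex.exp ((1 : ℂ) * t) -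
      Complex.exp (-t * (I * y)) * Complex.exp (w * t)) = Complex.exp (-t * (I * y)) * u t := by
    intro y t ht
    have ht : t ≤ 0 := ht
    simp only [hu, min_eq_left ht]
    ring
  have hJ : ∀ y : ℝ, ∀ t ∈ Set.Ioi (0 : ℝ), 0 = Complex.exp (-t * (I * y)) * u t := by
    intro y t ht
    have ht : 0 ≤ t := le_of_lt ht
    simp [hu, min_eq_right ht]
  have i1 := fun y => IntegrableOn.congr_fun (((integrableOn_exp_mul_Iic_zero hone y).sub
    (integrableOn_exp_mul_Iic_zero hw y)).const_mul (w - 1)⁻¹) (hI y) measurableSet_Iic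
  have i2 := fun y => (integrableOn_zero (μ := volume)).congr_fun (hJ y) measurableSet_Ioi
  have hcont : Continuous u := by fun_prop
  have hint : Integrable u := by
    simpa using integrable_of_Iic_Ioi (i1 0) (i2 0)
  have hU : Integrable fun y : ℝ => (1 - I * y)⁻¹ * (w - I * y)⁻¹ :=
    (memLp_inv_sub_I_mul hone).integrable_mul (memLp_inv_sub_I_mul hw)
  rw [integral_exp_mul_fourier_eq hcont hint hU]
  · simp [hu, min_eq_right ht]
  · intro y
    rw [← intervalIntegral.integral_Iic_add_Ioi (i1 y) (i2 y),
      ← setIntegral_congr_fun measurableSet_Iic (hI y),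
      ← setIntegral_congr_fun measurableSet_Ioi (hJ y), integral_const_mul,
      integral_sub (integrableOn_exp_mul_Iic_zero hone y) (integrableOn_exp_mul_Iic_zero hw y),
      integral_exp_mul_Iic_zero hw, integral_exp_mul_Iic_zero hone]
    have := sub_I_mul_ofReal_ne_zero hone y
    have := sub_I_mul_ofReal_ne_zero hw y
    simp only [integral_zero, add_zero]
    field_simp
    ring

theorem norm_exp_mul_I_mul (t y : ℝ) : ‖Complex.exp (t * (I * y))‖ = 1 := by
  rw [Complex.norm_exp]; simp

theorem integral_exp_mul_inv_sub_mul_inv_sub {w : ℂ} (hw : 0 < w.re) {t : ℝ} (ht : 0 ≤ t) :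
    ∫ y : ℝ, Complex.exp (t * (I * y)) * ((1 - I * y)⁻¹ * (w - I * y)⁻¹) = 0 := by
  by_cases hw1 : w ≠ 1
  · exact integral_exp_mul_inv_sub_mul_inv_sub_of_ne hw hw1 ht
  obtain rfl : w = 1 := not_not.1 hw1
  have hint : ∀ p : ℂ, 0 < p.re → Integrable fun y : ℝ => (1 - I * y)⁻¹ * (p - I * y)⁻¹ :=
    fun p hp => (memLp_inv_sub_I_mul hw).integrable_mul (memLp_inv_sub_I_mul hp)
  set C := ∫ y : ℝ, ‖(1 - I * (y : ℂ))⁻¹ * (1 - I * y)⁻¹‖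
  refine norm_eq_zero.1 (le_antisymm (le_of_forall_pos_le_add fun ε hε => ?_) (norm_nonneg _))
  -- compare with the nearby point `1 + η` through the resolvent identity
  set η : ℝ := ε / (C + 1) with hη
  have hC0 : 0 ≤ C := integral_nonneg fun _ => norm_nonneg _
  have hη0 : 0 < η := by positivity
  have hp : 0 < (1 + η : ℂ).re := by simp; linarith
  have hpne : (1 + η : ℂ) ≠ 1 := by simpa using hη0.ne'
  have hexp : ∀ f : ℝ → ℂ, Integrable f →
      Integrable fun y : ℝ => Complex.exp (t * (I * y)) * f y := fun f hf =>
    hf.bdd_mul (c := 1) (by apply Continuous.aestronglyMeasurable; fun_prop)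
      (Eventually.of_forall fun y => (norm_exp_mul_I_mul t y).le)
  rw [← sub_zero (∫ y : ℝ, _), ← integral_exp_mul_inv_sub_mul_inv_sub_of_ne hp hpne ht,
    ← integral_sub (hexp _ (hint 1 hw)) (hexp _ (hint _ hp))]
  calc _ ≤ ∫ y : ℝ, η * ‖(1 - I * (y : ℂ))⁻¹ * (1 - I * y)⁻¹‖ := by
        refine norm_integral_le_of_norm_le ((hint 1 hw).norm.const_mul _)
          (Eventually.of_forall fun y => ?_)
        have h1 := sub_I_mul_ofReal_ne_zero hw y
        have h2 := sub_I_mul_ofReal_ne_zero hp y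
        have h3 : (1 - I * (y : ℂ))⁻¹ * (1 - I * y)⁻¹ - (1 - I * (y : ℂ))⁻¹ * (1 + η - I * y)⁻¹
            = η * ((1 - I * (y : ℂ))⁻¹ * (1 - I * y)⁻¹) * (1 + η - I * y)⁻¹ := by
          field_simp
          ring
        rw [← mul_sub, h3, norm_mul, norm_exp_mul_I_mul, one_mul, norm_mul, norm_mul,
          Complex.norm_real, Real.norm_of_nonneg hη0.le]
        refine mul_le_of_le_one_right (by positivity) ?_
        rw [norm_inv]
        refine inv_le_one_of_one_le₀ ?_
        calc (1 : ℝ) ≤ |(1 + η - I * y : ℂ).re| := by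
              simp only [sub_re, add_re, one_re, ofReal_re, mul_re, I_re, I_im, ofReal_im]
              rw [abs_of_nonneg] <;> linarith
          _ ≤ _ := Complex.abs_re_le_norm _
    _ = η * C := by rw [integral_const_mul]
    _ ≤ 0 + ε := by
        rw [hη, zero_add, div_mul_eq_mul_div, div_le_iff₀ (by positivity)]
        nlinarith

instance : CompleteSpace Hplus :=
  (Submodule.isClosed_topologicalClosure _).completeSpace_coe

theorem L2R_inner_eq_integral {f g : L2R} {F G : ℝ → ℂ} (hf : f =ᵐ[volume] F)
    (hg : g =ᵐ[volume] G) : ⟪f, g⟫_ℂ = ∫ y : ℝ, conj (F y) * G y := by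
  rw [L2.inner_def]
  refine integral_congr_ae ?_
  filter_upwards [hf, hg] with y h1 h2
  rw [h1, h2, RCLike.inner_apply']

theorem norm_exp_neg_mul_I_mul (t y : ℝ) : ‖Complex.exp (-t * (I * y))‖ = 1 := by
  rw [Complex.norm_exp]; simp

theorem memLp_symbol_mul {m : ℝ → ℂ} (hm : Continuous m) (hb : ∀ y, ‖m y‖ ≤ 1) (f : L2R) :
    MemLp (fun y => m y * f y) 2 :=
  (Lp.memLp f).of_le (hm.aestronglyMeasurable.mul (Lp.aestronglyMeasurable f))
    (Eventually.of_forall fun y => by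
      rw [norm_mul]; exact mul_le_of_le_one_left (norm_nonneg _) (hb y))

/-- Multiplication by a continuous symbol of modulus at most one, as an operator on `L²`. -/
def mulSymbol (m : ℝ → ℂ) (hm : Continuous m) (hb : ∀ y, ‖m y‖ ≤ 1) : L2R →L[ℂ] L2R :=
  LinearMap.mkContinuous
    { toFun := fun f => (memLp_symbol_mul hm hb f).toLp _
      map_add' := fun f g => by
        rw [← MemLp.toLp_add]
        refine MemLp.toLp_congr _ _ ?_
        filter_upwards [Lp.coeFn_add f g] with y hy
        simp only [hy, Pi.add_apply, mul_add]
      map_smul' := fun c f => by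
        rw [RingHom.id_apply, ← MemLp.toLp_const_smul]
        refine MemLp.toLp_congr _ _ ?_
        filter_upwards [Lp.coeFn_smul c f] with y hy
        simp only [hy, Pi.smul_apply, smul_eq_mul]
        ring } 1
    fun f => by
      rw [one_mul]
      refine Lp.norm_le_norm_of_ae_le ?_
      filter_upwards [(memLp_symbol_mul hm hb f).coeFn_toLp] with y hy
      simp only [LinearMap.coe_mk, AddHom.coe_mk, hy, norm_mul]
      exact mul_le_of_le_one_left (norm_nonneg _) (hb y)

theorem coeFn_mulSymbol (m : ℝ → ℂ) (hm : Continuous m) (hb : ∀ y, ‖m y‖ ≤ 1) (f : L2R) :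
    mulSymbol m hm hb f =ᵐ[volume] fun y => m y * f y :=
  MemLp.coeFn_toLp (memLp_symbol_mul hm hb f)

theorem one_re_pos : 0 < (1 : ℂ).re := by simp

/-- The reproducing kernel at `w`, up to the factor `2π`. -/
def hardyKernel (w : ℂ) (hw : 0 < w.re) : L2R :=
  (memLp_inv_add_I_mul (p := conj w) (by simpa using hw)).toLp _

theorem coeFn_hardyKernel (w : ℂ) (hw : 0 < w.re) :
    hardyKernel w hw =ᵐ[volume] fun y : ℝ => (conj w + I * y)⁻¹ :=
  MemLp.coeFn_toLp _

theorem hardyKernel_mem_Hplus (w : ℂ) (hw : 0 < w.re) : hardyKernel w hw ∈ Hplus := by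
  refine Submodule.le_topologicalClosure _ (Submodule.subset_span ⟨w, hw, ?_⟩)
  filter_upwards [coeFn_hardyKernel w hw] with y hy
  rw [hy, add_comm]

theorem inner_hardyKernel_eq_integral (w : ℂ) (hw : 0 < w.re) {v : L2R} {V : ℝ → ℂ}
    (hv : v =ᵐ[volume] V) :
    ⟪hardyKernel w hw, v⟫_ℂ = ∫ y : ℝ, (w - I * y)⁻¹ * V y := by
  rw [L2R_inner_eq_integral (coeFn_hardyKernel w hw) hv]
  simp [sub_eq_add_neg]

theorem mem_Hplus_orthogonal {v : L2R} (h : ∀ w hw, ⟪hardyKernel w hw, v⟫_ℂ = 0) :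
    v ∈ Hplusᗮ := by
  have hle : Hplus ≤ (Submodule.span ℂ {v})ᗮ := by
    refine Submodule.topologicalClosure_minimal _ (Submodule.span_le.2 ?_)
      (Submodule.isClosed_orthogonal _)
    rintro f ⟨w, hw, hf⟩
    have : f = hardyKernel w hw := by
      refine Lp.ext (hf.trans ?_)
      filter_upwards [coeFn_hardyKernel w hw] with y hy
      rw [hy, add_comm]
    rw [SetLike.mem_coe, Submodule.mem_orthogonal_singleton_iff_inner_left, this, h]
  intro u hu
  exact Submodule.mem_orthogonal_singleton_iff_inner_left.1 (hle hu)

theorem memLp_shiftedExp (l : ℝ) :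
    MemLp (fun y : ℝ => (1 + I * y)⁻¹ * Complex.exp (-l * (I * y))) 2 := by
  refine (memLp_inv_add_I_mul one_re_pos).of_le
    (Continuous.aestronglyMeasurable ?_) (Eventually.of_forall fun y => ?_)
  · exact (Continuous.inv₀ (by fun_prop) (add_I_mul_ofReal_ne_zero one_re_pos)).mul (by fun_prop)
  · rw [norm_mul, norm_exp_neg_mul_I_mul, mul_one]

/-- The function `e^{-ls}/(1+s)` on the imaginary axis. -/
def shiftedExp (l : ℝ) : L2R := (memLp_shiftedExp l).toLp _

theorem coeFn_shiftedExp (l : ℝ) :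
    shiftedExp l =ᵐ[volume] fun y : ℝ => (1 + I * y)⁻¹ * Complex.exp (-l * (I * y)) :=
  MemLp.coeFn_toLp _

theorem shiftedExp_neg_sub_mem_orthogonal {t : ℝ} (ht : 0 ≤ t) :
    shiftedExp (-t) - Complex.exp (-t) • shiftedExp 0 ∈ Hplusᗮ := by
  refine mem_Hplus_orthogonal fun w hw => ?_
  have key : ∀ r : ℝ, 0 ≤ r → ⟪hardyKernel w hw, shiftedExp (-r)⟫_ℂ =
      2 * Real.pi * ((1 + w)⁻¹ * Complex.exp (-r)) := by
    intro r hr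
    rw [inner_hardyKernel_eq_integral w hw (coeFn_shiftedExp _),
      ← integral_exp_mul_inv_add_mul_inv_sub hw hr]
    congr with y
    rw [ofReal_neg, neg_neg]
    ring
  have h0 := key 0 le_rfl
  rw [neg_zero] at h0
  rw [inner_sub_right, inner_smul_right, key t ht, h0]
  simp
  ring

theorem memLp_inv_one_sub_mul_exp (a : ℝ) :
    MemLp (fun y : ℝ => (1 - I * y)⁻¹ * Complex.exp (a * (I * y))) 2 := by
  refine (memLp_inv_sub_I_mul one_re_pos).of_le
    (Continuous.aestronglyMeasurable ?_) (Eventually.of_forall fun y => ?_)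
  · exact (Continuous.inv₀ (by fun_prop) (sub_I_mul_ofReal_ne_zero one_re_pos)).mul (by fun_prop)
  · rw [norm_mul, norm_exp_mul_I_mul, mul_one]

theorem toLp_inv_one_sub_mul_exp_mem_orthogonal {a : ℝ} (ha : 0 ≤ a) :
    (memLp_inv_one_sub_mul_exp a).toLp _ ∈ Hplusᗮ := by
  refine mem_Hplus_orthogonal fun w hw => ?_
  rw [inner_hardyKernel_eq_integral w hw (MemLp.coeFn_toLp _),
    ← integral_exp_mul_inv_sub_mul_inv_sub hw ha]
  congr with y
  ring

theorem integrable_conj_mul_inv_one_add (g : L2R) :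
    Integrable fun y : ℝ => conj (g y) * (1 + I * y)⁻¹ :=
  (Lp.memLp g).star.integrable_mul (memLp_inv_add_I_mul one_re_pos)

theorem inner_shiftedExp_eq_integral (g : L2R) (t : ℝ) : ⟪g, shiftedExp t⟫_ℂ =
    ∫ y : ℝ, conj (g y) * (1 + I * y)⁻¹ * Complex.exp (-t * (I * y)) := by
  rw [L2R_inner_eq_integral EventuallyEq.rfl (coeFn_shiftedExp t)]
  congr with y
  ring

theorem continuous_inner_shiftedExp (g : L2R) : Continuous fun t => ⟪g, shiftedExp t⟫_ℂ := by
  simp_rw [inner_shiftedExp_eq_integral]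
  have hψ := integrable_conj_mul_inv_one_add g
  refine continuous_of_dominated (fun t => ?_) (fun t => Eventually.of_forall fun y => ?_) hψ.norm
    (Eventually.of_forall fun y => by fun_prop)
  · exact hψ.aestronglyMeasurable.mul (Continuous.aestronglyMeasurable (by fun_prop))
  · rw [norm_mul _ (Complex.exp _), norm_exp_neg_mul_I_mul, mul_one]

theorem inner_shiftedExp_eq_zero {g : L2R} (hg : g ∈ Hplusᗮ) {t : ℝ} (ht : 0 ≤ t) :
    ⟪g, shiftedExp t⟫_ℂ = 0 := by
  have hψ := integrable_conj_mul_inv_one_add g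
  set κ : ℂ → ℝ → ℂ := fun p => (Set.Ioi (0 : ℝ)).indicator fun t => Complex.exp (-p * t) with hκ
  have hκi : ∀ p : ℂ, 0 < p.re → Integrable (κ p) := by
    intro p hp
    rw [hκ, integrable_indicator_iff measurableSet_Ioi]
    simpa using integrableOn_exp_neg_mul_Ioi_zero hp 0
  have hκF : ∀ p : ℂ, 0 < p.re → ∀ y : ℝ,
      ∫ t : ℝ, κ p t * Complex.exp (-t * (I * y)) = (p + I * y)⁻¹ := by
    intro p hp y
    rw [← integral_exp_neg_mul_Ioi_zero hp y, ← integral_indicator measurableSet_Ioi]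
    congr with t
    simp only [hκ, Set.indicator]
    split_ifs <;> ring
  have hlap : ∀ l : ℝ, ∫ t : ℝ, κ (2 - l * I) t * ⟪g, shiftedExp t⟫_ℂ = 0 := by
    intro l
    have hp : 0 < (2 - l * I : ℂ).re := by simp
    simp_rw [inner_shiftedExp_eq_integral]
    rw [← integral_mul_integral_exp_swap hψ (hκi _ hp)]
    simp_rw [hκF _ hp]
    have hp' : 0 < (conj (2 - l * I : ℂ)).re := by simp
    have hp1 : (2 - l * I : ℂ) - 1 ≠ 0 := by
      intro h
      have := congrArg Complex.re h
      norm_num at this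
    rw [integral_congr_ae (g := fun y : ℝ => ((2 - l * I : ℂ) - 1)⁻¹ * (conj (g y) *
      ((1 + I * y)⁻¹ - (2 - l * I + I * y)⁻¹)))]
    · rw [integral_const_mul]
      have e2 : ⟪g, hardyKernel 1 one_re_pos - hardyKernel _ hp'⟫_ℂ = 0 :=
        Submodule.inner_left_of_mem_orthogonal
          (sub_mem (hardyKernel_mem_Hplus _ _) (hardyKernel_mem_Hplus _ _)) hg
      rw [L2R_inner_eq_integral (f := g) EventuallyEq.rfl ((Lp.coeFn_sub _ _).trans
        ((coeFn_hardyKernel 1 one_re_pos).sub (coeFn_hardyKernel _ hp')))] at e2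
      simp only [Pi.sub_apply, map_one, Complex.conj_conj] at e2
      rw [e2, mul_zero]
    · refine Eventually.of_forall fun y => ?_
      have h1 := add_I_mul_ofReal_ne_zero one_re_pos y
      have h2 := add_I_mul_ofReal_ne_zero hp y
      have h3 : (1 + I * (y : ℂ))⁻¹ * (2 - l * I + I * y)⁻¹ = ((2 - l * I : ℂ) - 1)⁻¹ *
          ((1 + I * (y : ℂ))⁻¹ - (2 - l * I + I * y)⁻¹) := by
        revert h2 hp1
        generalize (2 - (l : ℂ) * I) = p
        intro hp1 h2
        field_simp
        ring
      simp only [mul_assoc, h3]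
      ring
  have hΨ := continuous_inner_shiftedExp g
  have hae : (fun t => κ 2 t * ⟪g, shiftedExp t⟫_ℂ) =ᵐ[volume] 0 := by
    refine ae_eq_zero_of_forall_integral_exp_mul_eq_zero ?_ fun l => ?_
    · refine (hκi 2 (by simp)).mul_bdd (c := ‖g‖ * ‖shiftedExp 0‖) hΨ.aestronglyMeasurable
        (Eventually.of_forall fun t => ?_)
      refine (norm_inner_le_norm _ _).trans (mul_le_mul_of_nonneg_left ?_ (norm_nonneg _))
      refine Lp.norm_le_norm_of_ae_le ?_
      filter_upwards [coeFn_shiftedExp t, coeFn_shiftedExp 0] with y h1 h2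
      rw [h1, h2, norm_mul, norm_mul, norm_exp_neg_mul_I_mul, norm_exp_neg_mul_I_mul]
    · rw [← hlap l]
      congr with t
      simp only [hκ, Set.indicator]
      split_ifs
      · rw [← mul_assoc, ← Complex.exp_add]
        ring_nf
      · simp
  have hopen : Set.EqOn (fun t => ⟪g, shiftedExp t⟫_ℂ) (fun _ => 0) (Set.Ioi (0 : ℝ)) := by
    refine Measure.eqOn_open_of_ae_eq (μ := volume) ?_ isOpen_Ioi hΨ.continuousOn
      continuousOn_const
    rw [EventuallyEq, ae_restrict_iff' measurableSet_Ioi]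
    filter_upwards [hae] with t h1 h2
    simpa [hκ, Set.indicator_of_mem h2, Complex.exp_ne_zero] using h1
  have hcl := hopen.closure hΨ continuous_const
  rw [closure_Ioi] at hcl
  exact hcl ht

theorem shiftedExp_mem_Hplus {t : ℝ} (ht : 0 ≤ t) : shiftedExp t ∈ Hplus := by
  rw [← Submodule.orthogonal_orthogonal Hplus]
  exact fun g hg => inner_shiftedExp_eq_zero hg ht

theorem integral_exp_indicator_Ioc {μ : ℝ} (hμ : 0 ≤ μ) (y : ℝ) :
    ∫ t : ℝ, (Set.Ioc 0 μ).indicator (fun t : ℝ => Complex.exp t) t * Complex.exp (-t * (I * y)) =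
      Complex.exp μ * ((1 - I * y)⁻¹ * (Complex.exp (-μ * (I * y)) - Complex.exp (-μ))) := by
  have h1 := sub_I_mul_ofReal_ne_zero one_re_pos y
  have h := integral_exp_mul_complex (a := 0) (b := μ) h1
  rw [intervalIntegral.integral_of_le hμ, ← integral_indicator measurableSet_Ioc] at h
  have e1 : Complex.exp ((1 - I * y) * μ) = Complex.exp μ * Complex.exp (-μ * (I * y)) := by
    rw [← Complex.exp_add]
    ring_nf
  have e2 : Complex.exp μ * Complex.exp (-μ) = 1 := by
    rw [← Complex.exp_add]
    simp
  rw [ofReal_zero, mul_zero, Complex.exp_zero, e1] at h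
  rw [mul_left_comm, mul_sub, e2, ← div_eq_inv_mul, ← h]
  congr with t
  simp only [Set.indicator]
  split_ifs
  · rw [← Complex.exp_add]
    ring_nf
  · simp

theorem norm_inv_one_sub_mul_exp_sub_le {μ : ℝ} (hμ : 0 ≤ μ) (y : ℝ) :
    ‖(1 - I * (y : ℂ))⁻¹ * (Complex.exp (-μ * (I * y)) - Complex.exp (-μ))‖ ≤ 2 := by
  have h1 : ‖(1 - I * (y : ℂ))⁻¹‖ ≤ 1 := by
    rw [norm_inv]
    refine inv_le_one_of_one_le₀ ?_
    simpa using Complex.abs_re_le_norm (1 - I * (y : ℂ))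
  have h2 : ‖Complex.exp (-μ)‖ ≤ 1 := by
    rw [Complex.norm_exp]
    simpa using hμ
  have h3 := (norm_sub_le (Complex.exp (-μ * (I * y))) (Complex.exp (-μ))).trans
    (add_le_add (norm_exp_neg_mul_I_mul μ y).le h2)
  rw [norm_mul]
  nlinarith [norm_nonneg (1 - I * (y : ℂ))⁻¹]

/-- The function `(e^{-μs} - e^{-μ})/(1-s)`, whose singularity at `s = 1` is removable, lies in
the Hardy space. -/
theorem exists_mem_Hplus_inv_one_sub {μ : ℝ} (hμ : 0 ≤ μ) : ∃ h ∈ Hplus, h =ᵐ[volume]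
    fun y : ℝ => (1 - I * y)⁻¹ * (Complex.exp (-μ * (I * y)) - Complex.exp (-μ)) := by
  have hmem : MemLp (fun y : ℝ => (1 + I * (y : ℂ))⁻¹ *
      ((1 - I * y)⁻¹ * (Complex.exp (-μ * (I * y)) - Complex.exp (-μ)))) 2 := by
    refine (memLp_inv_add_I_mul one_re_pos).of_le_mul (c := 2)
      (Continuous.aestronglyMeasurable ?_) (Eventually.of_forall fun y => ?_)
    · exact (Continuous.inv₀ (by fun_prop) (add_I_mul_ofReal_ne_zero one_re_pos)).mul
        ((Continuous.inv₀ (by fun_prop) (sub_I_mul_ofReal_ne_zero one_re_pos)).mul (by fun_prop))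
    · rw [norm_mul, mul_comm]
      exact mul_le_mul_of_nonneg_right (norm_inv_one_sub_mul_exp_sub_le hμ y) (norm_nonneg _)
  have hR : hmem.toLp _ ∈ Hplus := by
    rw [← Submodule.orthogonal_orthogonal Hplus]
    intro g hg
    have hκ : Integrable ((Set.Ioc 0 μ).indicator fun t : ℝ => Complex.exp t) := by
      rw [integrable_indicator_iff measurableSet_Ioc]
      exact (Continuous.integrableOn_Icc (by fun_prop)).mono_set Set.Ioc_subset_Icc_self
    have h := integral_mul_integral_exp_swap (integrable_conj_mul_inv_one_add g) hκ
    simp_rw [integral_exp_indicator_Ioc hμ, ← inner_shiftedExp_eq_integral] at h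
    have h0 : ∀ t : ℝ, (Set.Ioc 0 μ).indicator (fun t : ℝ => Complex.exp t) t *
        ⟪g, shiftedExp t⟫_ℂ = 0 := by
      intro t
      by_cases ht : t ∈ Set.Ioc 0 μ
      · rw [inner_shiftedExp_eq_zero hg ht.1.le, mul_zero]
      · rw [Set.indicator_of_notMem ht, zero_mul]
    simp only [h0, integral_zero] at h
    rw [L2R_inner_eq_integral EventuallyEq.rfl hmem.coeFn_toLp]
    refine (mul_eq_zero.1 ?_).resolve_left (Complex.exp_ne_zero μ)
    rw [← integral_const_mul, ← h]
    congr with y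
    ring
  refine ⟨(2 : ℂ) • hmem.toLp _ - (shiftedExp μ - Complex.exp (-μ) • shiftedExp 0),
    sub_mem (Submodule.smul_mem _ _ hR) (sub_mem (shiftedExp_mem_Hplus hμ)
      (Submodule.smul_mem _ _ (shiftedExp_mem_Hplus le_rfl))), ?_⟩
  filter_upwards [Lp.coeFn_sub ((2 : ℂ) • hmem.toLp _)
      (shiftedExp μ - Complex.exp (-μ) • shiftedExp 0),
    Lp.coeFn_sub (shiftedExp μ) (Complex.exp (-μ) • shiftedExp 0),
    Lp.coeFn_smul (2 : ℂ) (hmem.toLp _), Lp.coeFn_smul (Complex.exp (-μ)) (shiftedExp 0),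
    hmem.coeFn_toLp, coeFn_shiftedExp μ, coeFn_shiftedExp 0] with y h1 h2 h3 h4 h5 h6 h7
  rw [h1, Pi.sub_apply, h2, Pi.sub_apply, h3, h4, Pi.smul_apply, Pi.smul_apply, h5, h6, h7]
  have e1 := sub_I_mul_ofReal_ne_zero one_re_pos y
  have e2 := add_I_mul_ofReal_ne_zero one_re_pos y
  simp only [smul_eq_mul, ofReal_zero, neg_zero, zero_mul, Complex.exp_zero]
  field_simp
  ring

/-- The closed span `N(1/(1+s))` as a submodule. -/
def shiftedExpSpan (δ : ℝ) : Submodule ℂ L2R :=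
  (Submodule.span ℂ {f : L2R | ∃ lam : ℝ, 0 ≤ lam ∧ lam ≤ δ ∧
    (f : ℝ → ℂ) =ᵐ[volume] fun y : ℝ =>
      (1 + Complex.I * y)⁻¹ * Complex.exp (-(lam : ℂ) * (Complex.I * y))}).topologicalClosure

instance (δ : ℝ) : CompleteSpace (shiftedExpSpan δ) :=
  (Submodule.isClosed_topologicalClosure _).completeSpace_coe

theorem shiftedExp_mem_shiftedExpSpan {δ l : ℝ} (h0 : 0 ≤ l) (h1 : l ≤ δ) :
    shiftedExp l ∈ shiftedExpSpan δ :=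
  Submodule.le_topologicalClosure _ (Submodule.subset_span ⟨l, h0, h1, coeFn_shiftedExp l⟩)

theorem shiftedExpSpan_le {δ : ℝ} {K : Submodule ℂ L2R} (hK : IsClosed (K : Set L2R))
    (h : ∀ l, 0 ≤ l → l ≤ δ → shiftedExp l ∈ K) : shiftedExpSpan δ ≤ K := by
  refine Submodule.topologicalClosure_minimal _ (Submodule.span_le.2 ?_) hK
  rintro f ⟨l, h0, h1, hf⟩
  rw [show f = shiftedExp l from Lp.ext (hf.trans (coeFn_shiftedExp l).symm)]
  exact h l h0 h1

theorem shiftedExpSpan_le_Hplus (δ : ℝ) : shiftedExpSpan δ ≤ Hplus :=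
  shiftedExpSpan_le (Submodule.isClosed_topologicalClosure _) fun _ h0 _ => shiftedExp_mem_Hplus h0

theorem bwdInvP_shiftedExpSpan {δ : ℝ} (hδ : 0 ≤ δ) : BwdInvP (shiftedExpSpan δ : Set L2R) := by
  intro t ht f hf
  set M : L2R →L[ℂ] L2R := mulSymbol (fun y : ℝ => Complex.exp (t * (I * y))) (by fun_prop)
    (fun y => (norm_exp_mul_I_mul t y).le)
  have hMc : ∀ g : L2R, M g =ᵐ[volume] fun y : ℝ => Complex.exp (t * (I * y)) * g y :=
    fun g => coeFn_mulSymbol _ _ _ g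
  have hMs : ∀ l, M (shiftedExp l) = shiftedExp (l - t) := by
    intro l
    refine Lp.ext ?_
    filter_upwards [hMc (shiftedExp l), coeFn_shiftedExp l, coeFn_shiftedExp (l - t)]
      with y h1 h2 h3
    rw [h1, h2, h3, mul_left_comm, ← Complex.exp_add]
    push_cast
    ring_nf
  have hle : shiftedExpSpan δ ≤
      (shiftedExpSpan δ).comap ((Hplus.starProjection ∘L M : L2R →L[ℂ] L2R) : L2R →ₗ[ℂ] L2R) := by
    refine shiftedExpSpan_le ((Submodule.isClosed_topologicalClosure _).preimage
      (Hplus.starProjection ∘L M).continuous) fun l h0 h1 => ?_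
    change Hplus.starProjection (M (shiftedExp l)) ∈ shiftedExpSpan δ
    rw [hMs]
    rcases le_total t l with h | h
    · rw [Submodule.starProjection_eq_self_iff.2 (shiftedExp_mem_Hplus (sub_nonneg.2 h))]
      exact shiftedExp_mem_shiftedExpSpan (sub_nonneg.2 h) (by linarith)
    · have ho := shiftedExp_neg_sub_mem_orthogonal (sub_nonneg.2 h)
      rw [neg_sub] at ho
      rw [Submodule.eq_starProjection_of_mem_orthogonal
        (Submodule.smul_mem _ _ (shiftedExp_mem_Hplus le_rfl)) ho]
      exact Submodule.smul_mem _ _ (shiftedExp_mem_shiftedExpSpan le_rfl hδ)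
  refine ⟨Hplus.starProjection (M f), hle hf, fun h hh => ?_⟩
  rw [← Submodule.inner_right_of_mem_orthogonal hh
    (Submodule.sub_starProjection_mem_orthogonal (K := Hplus) (M f))]
  refine (L2R_inner_eq_integral EventuallyEq.rfl ((Lp.coeFn_sub _ _).trans ?_)).symm
  filter_upwards [hMc f] with y hy
  rw [Pi.sub_apply, hy]

theorem eq_zero_of_forall_inner_shiftedExp_eq_zero {f : L2R}
    (h : ∀ l, ⟪shiftedExp l, f⟫_ℂ = 0) : f = 0 := by
  have hφ : Integrable fun y : ℝ => (1 - I * y)⁻¹ * f y :=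
    (memLp_inv_sub_I_mul one_re_pos).integrable_mul (Lp.memLp f)
  have hae := ae_eq_zero_of_forall_integral_exp_mul_eq_zero hφ fun l => by
    rw [← h l, L2R_inner_eq_integral (coeFn_shiftedExp l) EventuallyEq.rfl]
    congr with y
    rw [map_mul, ← Complex.exp_conj]
    simp [sub_eq_add_neg]
    ring
  refine Lp.ext ?_
  filter_upwards [hae, Lp.coeFn_zero ℂ 2 (volume : Measure ℝ)] with y h1 h2
  rw [h2]
  simpa [sub_I_mul_ofReal_ne_zero one_re_pos y] using h1

theorem shiftedExpSpan_eq_KmodP {δ : ℝ} (hδ : 0 ≤ δ) : (shiftedExpSpan δ : Set L2R) =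
    KmodP (fun y : ℝ => (1 - Complex.I * y) / (1 + Complex.I * y) *
      Complex.exp (-(δ : ℂ) * (Complex.I * y))) := by
  set θ : ℝ → ℂ := fun y : ℝ => (1 - Complex.I * y) / (1 + Complex.I * y) *
    Complex.exp (-(δ : ℂ) * (Complex.I * y)) with hθ
  have hθc : Continuous θ :=
    (Continuous.div (by fun_prop) (by fun_prop) (add_I_mul_ofReal_ne_zero one_re_pos)).mul
      (by fun_prop)
  have hθb : ∀ y, ‖θ y‖ ≤ 1 := by
    intro y
    have hconj : (1 - I * (y : ℂ)) = conj (1 + I * (y : ℂ)) := by simp [sub_eq_add_neg]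
    rw [hθ, norm_mul, norm_exp_neg_mul_I_mul, mul_one, norm_div, hconj, Complex.norm_conj]
    exact div_self_le_one _
  set M := mulSymbol θ hθc hθb
  have hinner : ∀ h f : L2R, ∫ y : ℝ, conj (θ y * h y) * f y = ⟪M h, f⟫_ℂ := fun h f =>
    (L2R_inner_eq_integral (coeFn_mulSymbol θ hθc hθb h) EventuallyEq.rfl).symm
  have hNorth : ∀ h ∈ Hplus, shiftedExpSpan δ ≤ (Submodule.span ℂ {M h})ᗮ := by
    intro h hh
    refine shiftedExpSpan_le (Submodule.isClosed_orthogonal _) fun l h0 h1 => ?_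
    rw [Submodule.mem_orthogonal_singleton_iff_inner_right, ← Submodule.inner_right_of_mem_orthogonal
      hh (toLp_inv_one_sub_mul_exp_mem_orthogonal (sub_nonneg.2 h1)),
      L2R_inner_eq_integral (coeFn_mulSymbol θ hθc hθb h) (coeFn_shiftedExp l),
      L2R_inner_eq_integral EventuallyEq.rfl (MemLp.coeFn_toLp _)]
    congr with y
    have e1 := sub_I_mul_ofReal_ne_zero one_re_pos y
    have e2 := add_I_mul_ofReal_ne_zero one_re_pos y
    have e3 : conj (θ y) = (1 + I * y) / (1 - I * y) * Complex.exp (δ * (I * y)) := by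
      rw [hθ, map_mul, ← Complex.exp_conj]
      simp [sub_eq_add_neg]
    have e4 : Complex.exp (((δ - l : ℝ) : ℂ) * (I * y)) =
        Complex.exp (δ * (I * y)) * Complex.exp (-l * (I * y)) := by
      rw [← Complex.exp_add]
      push_cast
      ring_nf
    rw [map_mul, e3, e4]
    field_simp
  ext f
  constructor
  · intro hf
    refine ⟨shiftedExpSpan_le_Hplus δ hf, fun h hh => ?_⟩
    rw [hinner]
    exact Submodule.mem_orthogonal_singleton_iff_inner_right.1 (hNorth h hh hf)
  · rintro ⟨hfH, hf⟩
    simp_rw [hinner] at hf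
    set n := (shiftedExpSpan δ).starProjection f
    have hnN : n ∈ shiftedExpSpan δ := Submodule.starProjection_apply_mem _ _
    have hortho : f - n ∈ (shiftedExpSpan δ)ᗮ := Submodule.sub_starProjection_mem_orthogonal f
    have hH : f - n ∈ Hplus := sub_mem hfH (shiftedExpSpan_le_Hplus δ hnN)
    have hK : ∀ h ∈ Hplus, ⟪M h, f - n⟫_ℂ = 0 := fun h hh => by
      rw [inner_sub_right, hf h hh,
        Submodule.mem_orthogonal_singleton_iff_inner_right.1 (hNorth h hh hnN), sub_zero]
    have hmid : ∀ l, 0 ≤ l → l ≤ δ → ⟪shiftedExp l, f - n⟫_ℂ = 0 := fun l h0 h1 =>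
      Submodule.inner_right_of_mem_orthogonal (shiftedExp_mem_shiftedExpSpan h0 h1) hortho
    have hz : f - n = 0 := by
      refine eq_zero_of_forall_inner_shiftedExp_eq_zero fun l => ?_
      rcases lt_or_ge l 0 with hl | hl
      · have h1 := Submodule.inner_left_of_mem_orthogonal hH
          (shiftedExp_neg_sub_mem_orthogonal (t := -l) (by linarith))
        rwa [inner_sub_left, inner_smul_left, hmid 0 le_rfl hδ, mul_zero, sub_zero, neg_neg] at h1
      rcases le_total l δ with hl' | hl'
      · exact hmid l hl hl'
      · obtain ⟨h, hh, hhe⟩ := exists_mem_Hplus_inv_one_sub (sub_nonneg.2 hl')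
        have hdec : shiftedExp l = M h + Complex.exp (-((l - δ : ℝ) : ℂ)) • shiftedExp δ := by
          refine Lp.ext ?_
          filter_upwards [coeFn_shiftedExp l, coeFn_shiftedExp δ, hhe,
            coeFn_mulSymbol θ hθc hθb h,
            Lp.coeFn_add (M h) (Complex.exp (-((l - δ : ℝ) : ℂ)) • shiftedExp δ),
            Lp.coeFn_smul (Complex.exp (-((l - δ : ℝ) : ℂ))) (shiftedExp δ)]
            with y h1 h2 h3 h4 h5 h6
          have e1 := sub_I_mul_ofReal_ne_zero one_re_pos y
          have e2 := add_I_mul_ofReal_ne_zero one_re_pos y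
          have e4 : Complex.exp (-l * (I * y)) =
              Complex.exp (-δ * (I * y)) * Complex.exp (-((l - δ : ℝ) : ℂ) * (I * y)) := by
            rw [← Complex.exp_add]
            push_cast
            ring_nf
          rw [h5, Pi.add_apply, h6, Pi.smul_apply, h1, h2, h4, h3, e4, hθ]
          simp only [smul_eq_mul]
          field_simp
          ring
        rw [hdec, inner_add_left, inner_smul_left, hK h hh, hmid δ hδ le_rfl, mul_zero, add_zero]
    rw [sub_eq_zero.1 hz]
    exact hnN

/-- `N(1/(1+s))` is backward-shift invariant and equals the model
space `K_θ`, `θ(s) = ((1-s)/(1+s)) e^{-δ s}` (boundary values at `s = iy`). -/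
theorem cyclic_stmt12 (δ : ℝ) (hδ : 0 < δ) :
    BwdInvP (NspanP δ fun y : ℝ => (1 + Complex.I * y)⁻¹) ∧
    NspanP δ (fun y : ℝ => (1 + Complex.I * y)⁻¹)
      = KmodP (fun y : ℝ => (1 - Complex.I * y) / (1 + Complex.I * y) *
          Complex.exp (-(δ : ℂ) * (Complex.I * y))) := by
  exact ⟨bwdInvP_shiftedExpSpan hδ.le, shiftedExpSpan_eq_KmodP hδ.le⟩

end
end

section
/- For every n ∈ ℕ₀ and δ > 0, the closed subspace N(1/(1+s)^{n+1}) of H²(ℂ₊) spanned by {e^{−λs}/(1+s)^{n+1} : 0 ≤ λ ≤ δ} is backward shift-invariant and equals the model space K_θ with θ(s) = ((1−s)/(1+s))^{n+1}·e^{−δs}. -/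
open MeasureTheory Complex Filter

noncomputable section

/-- The conjugate `1/(w - iy)` of the reproducing kernel at `w`, on the boundary `s = iy`. -/
def conjKernel (w : ℂ) (y : ℝ) : ℂ := (w - I * y)⁻¹

/-- The boundary values `e^{iay}` of `e^{as}`. -/
def phase (a : ℝ) (y : ℝ) : ℂ := exp ((a : ℂ) * (I * y))

theorem sub_I_mul_ne_zero {w : ℂ} (hw : 0 < w.re) (y : ℝ) : w - I * y ≠ 0 := by
  intro h
  have := congrArg Complex.re h
  simp at this
  exact hw.ne' this

theorem continuous_conjKernel {w : ℂ} (hw : 0 < w.re) : Continuous (conjKernel w) := by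
  unfold conjKernel
  exact Continuous.inv₀ (by fun_prop) (sub_I_mul_ne_zero hw)

theorem norm_conjKernel_le {w : ℂ} (hw : 0 < w.re) (y : ℝ) : ‖conjKernel w y‖ ≤ w.re⁻¹ := by
  rw [conjKernel, norm_inv]
  refine inv_anti₀ hw ?_
  simpa using Complex.re_le_norm (w - I * y)

theorem memLp_conjKernel {w : ℂ} (hw : 0 < w.re) : MemLp (conjKernel w) 2 volume := by
  rw [memLp_two_iff_integrable_sq_norm (continuous_conjKernel hw).aestronglyMeasurable]
  have h := (((integrable_inv_one_add_sq.comp_div hw.ne').comp_sub_right w.im).const_mul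
    (w.re ^ 2)⁻¹)
  refine h.congr (Eventually.of_forall fun y => ?_)
  have hn : ‖w - I * y‖ ^ 2 = w.re ^ 2 * (1 + ((y - w.im) / w.re) ^ 2) := by
    rw [← Complex.normSq_eq_norm_sq, Complex.normSq_apply]
    simp
    field_simp
    ring
  simp only [conjKernel, norm_inv, inv_pow, hn, mul_inv]

theorem continuous_phase (a : ℝ) : Continuous (phase a) := by
  unfold phase
  fun_prop

theorem norm_phase (a y : ℝ) : ‖phase a y‖ = 1 := by
  simp [phase, Complex.norm_exp]

theorem phase_zero (y : ℝ) : phase 0 y = 1 := by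
  simp [phase]

theorem phase_add (a b y : ℝ) : phase (a + b) y = phase a y * phase b y := by
  simp only [phase, ← Complex.exp_add]
  push_cast
  ring_nf

theorem memLp_bdd_mul {m u : ℝ → ℂ} {C : ℝ} (hu : MemLp u 2 volume) (hm : Continuous m)
    (hC : ∀ y, ‖m y‖ ≤ C) : MemLp (fun y => m y * u y) 2 volume :=
  hu.of_le_mul (hm.aestronglyMeasurable.mul hu.1) (c := C) <| Eventually.of_forall fun y => by
    rw [norm_mul]
    gcongr
    exact hC y

theorem memLp_phase_mul {u : ℝ → ℂ} (hu : MemLp u 2 volume) (a : ℝ) :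
    MemLp (fun y => phase a y * u y) 2 volume :=
  memLp_bdd_mul hu (continuous_phase a) fun y => (norm_phase a y).le

theorem memLp_conjKernel_mul {u : ℝ → ℂ} (hu : MemLp u 2 volume) {w : ℂ} (hw : 0 < w.re) :
    MemLp (fun y => conjKernel w y * u y) 2 volume :=
  memLp_bdd_mul hu (continuous_conjKernel hw) (norm_conjKernel_le hw)

theorem integrable_conjKernel_mul {u : ℝ → ℂ} (hu : MemLp u 2 volume) {w : ℂ} (hw : 0 < w.re) :
    Integrable (fun y => conjKernel w y * u y) :=
  (memLp_conjKernel hw).integrable_mul hu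

theorem integrable_phase_mul {F : ℝ → ℂ} (hF : Integrable F) (a : ℝ) :
    Integrable (fun y => phase a y * F y) :=
  hF.bdd_mul (c := 1) (continuous_phase a).aestronglyMeasurable
    (Eventually.of_forall fun y => (norm_phase a y).le)

theorem conjKernel_mul_conjKernel {v w : ℂ} (hv : 0 < v.re) (hw : 0 < w.re) (hvw : v ≠ w)
    (y : ℝ) :
    conjKernel v y * conjKernel w y = (w - v)⁻¹ * (conjKernel v y - conjKernel w y) := by
  have h1 := sub_I_mul_ne_zero hv y
  have h2 := sub_I_mul_ne_zero hw y
  have h3 : w - v ≠ 0 := sub_ne_zero.2 hvw.symm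
  unfold conjKernel
  field_simp
  ring

/-- The Laplace transform of the Fourier integral of an integrable function. -/
theorem laplace_integral_phase_mul {F : ℝ → ℂ} (hF : Integrable F) {v : ℂ} (hv : 0 < v.re) :
    ∫ t in Set.Ioi (0 : ℝ), exp (-v * t) * ∫ y, phase t y * F y
      = ∫ y, conjKernel v y * F y := by
  have hprod : Integrable (Function.uncurry fun (t y : ℝ) => exp (-v * t) * (phase t y * F y))
      ((volume.restrict (Set.Ioi 0)).prod volume) := by
    have he : Integrable (fun t : ℝ => exp (-v * t)) (volume.restrict (Set.Ioi 0)) :=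
      integrableOn_exp_mul_complex_Ioi (by simpa using hv) 0
    have h := (he.mul_prod hF).bdd_mul (c := 1) (f := fun z : ℝ × ℝ => phase z.1 z.2)
      (by unfold phase; fun_prop)
      (Eventually.of_forall fun z => (norm_phase z.1 z.2).le)
    refine h.congr (Eventually.of_forall fun z => ?_)
    simp only [Function.uncurry]
    ring
  simp_rw [← integral_const_mul]
  rw [integral_integral_swap hprod]
  refine integral_congr_ae (Eventually.of_forall fun y => ?_)
  have hre : (-(v - I * y)).re < 0 := by simpa using hv
  have h := integral_exp_mul_complex_Ioi hre 0
  simp only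
  have h2 : ∀ t : ℝ, exp (-v * t) * (phase t y * F y) = exp (-(v - I * y) * t) * F y := by
    intro t
    rw [phase, ← mul_assoc, ← Complex.exp_add]
    ring_nf
  simp_rw [h2]
  rw [integral_mul_const, h]
  rw [neg_div_neg_eq]
  simp [conjKernel]

theorem continuous_integral_phase_mul {F : ℝ → ℂ} (hF : Integrable F) :
    Continuous fun t : ℝ => ∫ y, phase t y * F y := by
  refine continuous_of_dominated (bound := fun y => ‖F y‖)
    (fun t => (integrable_phase_mul hF t).1) (fun t => ?_) hF.norm ?_
  · exact Eventually.of_forall fun y => by rw [norm_mul, norm_phase, one_mul]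
  · exact Eventually.of_forall fun y => by unfold phase; fun_prop

/-- Uniqueness for the Laplace transform, in the form needed here. -/
theorem integral_phase_mul_eq_zero {F : ℝ → ℂ} (hF : Integrable F) {a : ℝ} (ha : 0 < a)
    (h : ∀ v : ℂ, v.re = a → ∫ y, conjKernel v y * F y = 0) {t : ℝ} (ht : 0 ≤ t) :
    ∫ y, phase t y * F y = 0 := by
  set ψ : ℝ → ℂ := fun t => ∫ y, phase t y * F y
  have hcont : Continuous ψ := continuous_integral_phase_mul hF
  set g : ℝ → ℂ := fun t => exp (-(a : ℂ) * t) * ψ t with hg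
  have hgc : Continuous g := by fun_prop
  set G : ℝ → ℂ := (Set.Ioi (0 : ℝ)).indicator g with hG
  have he : Integrable (fun t : ℝ => exp (-(a : ℂ) * t)) (volume.restrict (Set.Ioi 0)) :=
    integrableOn_exp_mul_complex_Ioi (by simpa using ha) 0
  have hGi : Integrable G := by
    rw [hG, integrable_indicator_iff measurableSet_Ioi]
    have := he.bdd_mul (f := ψ) (c := ∫ y, ‖F y‖) hcont.aestronglyMeasurable
      (Eventually.of_forall fun t => (norm_integral_le_integral_norm _).trans
        (by simp [norm_phase]))
    refine this.congr (Eventually.of_forall fun t => ?_)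
    simp only [hg]
    ring
  have hFG : FourierTransform.fourier G = 0 := by
    ext ξ
    rw [Real.fourier_real_eq_integral_exp_smul]
    have hv : 0 < ((a : ℂ) + 2 * Real.pi * ξ * I).re := by simpa using ha
    have := laplace_integral_phase_mul hF hv
    rw [h _ (by simp), ← integral_indicator measurableSet_Ioi] at this
    rw [Pi.zero_apply, ← this]
    refine integral_congr_ae (Eventually.of_forall fun t => ?_)
    by_cases htp : t ∈ Set.Ioi (0 : ℝ)
    · simp only [hG, hg, Set.indicator_of_mem htp, smul_eq_mul]
      rw [← mul_assoc, ← Complex.exp_add]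
      congr 2
      push_cast
      ring
    · simp only [hG, Set.indicator_of_notMem htp, smul_zero]
  have hpos : ∀ r : ℝ, 0 < r → ψ r = 0 := by
    intro r hr
    have hev : G =ᶠ[nhds r] g := by
      filter_upwards [Ioi_mem_nhds hr] with x hx
      exact Set.indicator_of_mem hx g
    have h1 := hGi.fourierInv_fourier_eq (by rw [hFG]; exact integrable_zero _ _ _)
      (hgc.continuousAt.congr hev.symm)
    have h2 : g r = 0 := by
      rw [← hev.eq_of_nhds, ← h1, hFG]
      simp [Real.fourierInv_eq']
    simpa [hg] using h2
  have hcl : closure (Set.Ioi (0 : ℝ)) ⊆ {r | ψ r = 0} :=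
    closure_minimal hpos (isClosed_eq hcont continuous_const)
  rw [closure_Ioi] at hcl
  exact hcl ht

/-- `u ∈ L²` is annihilated by all conjugate kernels, i.e. is orthogonal to `Hplus`. -/
structure Annihilated (u : ℝ → ℂ) : Prop where
  memLp : MemLp u 2 volume
  integral_eq_zero : ∀ w : ℂ, 0 < w.re → ∫ y, conjKernel w y * u y = 0

namespace Annihilated

variable {u v : ℝ → ℂ}

theorem sub (hu : Annihilated u) (hv : Annihilated v) : Annihilated (fun y => u y - v y) where
  memLp := hu.memLp.sub hv.memLp
  integral_eq_zero w hw := by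
    simp_rw [mul_sub]
    rw [integral_sub (integrable_conjKernel_mul hu.memLp hw)
      (integrable_conjKernel_mul hv.memLp hw), hu.integral_eq_zero w hw,
      hv.integral_eq_zero w hw, sub_zero]

theorem const_mul (hu : Annihilated u) (c : ℂ) : Annihilated (fun y => c * u y) where
  memLp := hu.memLp.const_mul c
  integral_eq_zero w hw := by
    simp_rw [mul_left_comm _ c]
    rw [integral_const_mul, hu.integral_eq_zero w hw, mul_zero]

theorem integral_phase_mul_conjKernel_mul (hu : Annihilated u) {w : ℂ} (hw : 0 < w.re) {t : ℝ}
    (ht : 0 ≤ t) : ∫ y, phase t y * (conjKernel w y * u y) = 0 := by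
  refine integral_phase_mul_eq_zero (integrable_conjKernel_mul hu.memLp hw)
    (a := w.re + 1) (by linarith) (fun v hv => ?_) ht
  have hv0 : 0 < v.re := by linarith
  have hvw : v ≠ w := by
    rintro rfl
    linarith
  have h1 : ∀ y, conjKernel v y * (conjKernel w y * u y)
      = (w - v)⁻¹ * (conjKernel v y * u y - conjKernel w y * u y) := fun y => by
    rw [← mul_assoc, conjKernel_mul_conjKernel hv0 hw hvw]
    ring
  simp_rw [h1]
  rw [integral_const_mul, integral_sub (integrable_conjKernel_mul hu.memLp hv0)
    (integrable_conjKernel_mul hu.memLp hw), hu.integral_eq_zero v hv0, hu.integral_eq_zero w hw,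
    sub_zero, mul_zero]

theorem phase_mul (hu : Annihilated u) {t : ℝ} (ht : 0 ≤ t) :
    Annihilated (fun y => phase t y * u y) where
  memLp := memLp_phase_mul hu.memLp t
  integral_eq_zero w hw := by
    simp_rw [mul_left_comm (conjKernel w _)]
    exact hu.integral_phase_mul_conjKernel_mul hw ht

theorem conjKernel_mul (hu : Annihilated u) {w : ℂ} (hw : 0 < w.re) :
    Annihilated (fun y => conjKernel w y * u y) where
  memLp := memLp_conjKernel_mul hu.memLp hw
  integral_eq_zero v hv := by
    rw [← laplace_integral_phase_mul (integrable_conjKernel_mul hu.memLp hw) hv]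
    rw [setIntegral_congr_fun (g := fun _ => 0) measurableSet_Ioi]
    · simp
    · intro t ht
      simp [hu.integral_phase_mul_conjKernel_mul hw (le_of_lt ht)]

end Annihilated

theorem tendsto_conjKernel (w : ℂ) {l : Filter ℝ}
    (hl : Tendsto (fun y : ℝ => |y|) l atTop) : Tendsto (conjKernel w) l (nhds 0) := by
  refine tendsto_inv₀_cobounded.comp ?_
  rw [← tendsto_norm_atTop_iff_cobounded]
  refine tendsto_atTop_mono (fun y => ?_) (tendsto_atTop_add_const_right l (-‖w‖) hl)
  have := norm_sub_norm_le (I * (y : ℂ)) w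
  rw [norm_sub_rev] at this
  simp at this
  linarith

theorem log_sub_log_of_re_pos {a b : ℂ} (ha : 0 < a.re) (hb : 0 < b.re) :
    log a - log b = log (a / b) := by
  have ha0 : a ≠ 0 := by rintro rfl; simp at ha
  have hb0 : b ≠ 0 := by rintro rfl; simp at hb
  have h1 := abs_lt.1 (abs_arg_lt_pi_div_two_iff.2 (Or.inl ha))
  have h2 := abs_lt.1 (abs_arg_lt_pi_div_two_iff.2 (Or.inl hb))
  have hpi := Real.pi_pos
  have hbpi : b.arg ≠ Real.pi := by linarith
  rw [div_eq_mul_inv, log_mul ha0 (inv_ne_zero hb0), log_inv _ hbpi, sub_eq_add_neg]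
  rw [arg_inv, if_neg hbpi]
  constructor <;> linarith

theorem integral_conjKernel_mul_conjKernel {v w : ℂ} (hv : 0 < v.re) (hw : 0 < w.re) :
    ∫ y, conjKernel w y * conjKernel v y = 0 := by
  have hint := integrable_conjKernel_mul (memLp_conjKernel hv) hw
  have hlin : ∀ (z : ℂ) (y : ℝ), HasDerivAt (fun y : ℝ => z - I * (y : ℂ)) (-I) y := fun z y => by
    simpa using ((Complex.ofRealCLM.hasDerivAt (x := y)).const_mul I).const_sub z
  by_cases hvw : v = w
  · subst hvw
    have hd : ∀ y, HasDerivAt (fun y => -I * conjKernel v y)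
        (conjKernel v y * conjKernel v y) y := by
      intro y
      have h0 := sub_I_mul_ne_zero hv y
      have := ((hlin v y).inv h0).const_mul (-I)
      refine this.congr_deriv ?_
      unfold conjKernel
      field_simp
      simp
    have := integral_of_hasDerivAt_of_tendsto hd hint
      ((tendsto_conjKernel v tendsto_abs_atBot_atTop).const_mul (-I))
      ((tendsto_conjKernel v tendsto_abs_atTop_atTop).const_mul (-I))
    simpa using this
  · have hne : w - v ≠ 0 := sub_ne_zero.2 fun h => hvw h.symm
    have hd : ∀ y, HasDerivAt (fun y : ℝ => (w - v)⁻¹ * (I * (log (v - I * y) - log (w - I * y))))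
        (conjKernel w y * conjKernel v y) y := by
      intro y
      have h1 := (hlin v y).clog_real (Or.inl (by simpa using hv))
      have h2 := (hlin w y).clog_real (Or.inl (by simpa using hw))
      refine (((h1.sub h2).const_mul I).const_mul (w - v)⁻¹).congr_deriv ?_
      rw [mul_comm (conjKernel w y), conjKernel_mul_conjKernel hv hw hvw]
      unfold conjKernel
      linear_combination (-(w - v)⁻¹ * ((v - I * y)⁻¹ - (w - I * y)⁻¹)) * I_mul_I
    have hlim : ∀ l : Filter ℝ, Tendsto (fun y : ℝ => |y|) l atTop →
        Tendsto (fun y : ℝ => (w - v)⁻¹ * (I * (log (v - I * y) - log (w - I * y)))) l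
          (nhds 0) := by
      intro l hl
      have h1 : Tendsto (fun y => 1 + (v - w) * conjKernel w y) l (nhds 1) := by
        simpa using ((tendsto_conjKernel w hl).const_mul (v - w)).const_add 1
      have h2 := (h1.clog (by simp)).const_mul ((w - v)⁻¹ * I)
      simp only [log_one, mul_zero] at h2
      refine h2.congr fun y => ?_
      rw [log_sub_log_of_re_pos (by simpa using hv) (by simpa using hw), mul_assoc]
      congr 3
      have := sub_I_mul_ne_zero hw y
      unfold conjKernel
      field_simp
      ring
    have := integral_of_hasDerivAt_of_tendsto hd hint (hlim _ tendsto_abs_atBot_atTop)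
      (hlim _ tendsto_abs_atTop_atTop)
    simpa using this

theorem annihilated_conjKernel {v : ℂ} (hv : 0 < v.re) : Annihilated (conjKernel v) :=
  ⟨memLp_conjKernel hv, fun _ hw => integral_conjKernel_mul_conjKernel hv hw⟩

theorem L2R_inner_eq (f g : L2R) :
    inner ℂ f g = ∫ y : ℝ, (starRingEnd ℂ) (f y) * g y := by
  simp [L2.inner_def, RCLike.inner_apply, mul_comm]

theorem L2R_inner_toLp (f : L2R) {u : ℝ → ℂ} (hu : MemLp u 2 volume) :
    inner ℂ f (hu.toLp u) = ∫ y : ℝ, (starRingEnd ℂ) (f y) * u y := by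
  rw [L2R_inner_eq]
  refine integral_congr_ae ?_
  filter_upwards [hu.coeFn_toLp] with y hy
  rw [hy]

theorem inner_eq_zero_of_mem_closure_span {S : Set L2R} {x : L2R}
    (hS : ∀ f ∈ S, inner ℂ f x = 0) {f : L2R}
    (hf : f ∈ (Submodule.span ℂ S).topologicalClosure) : inner ℂ f x = 0 := by
  have hle : (Submodule.span ℂ S).topologicalClosure ≤ (Submodule.span ℂ {x})ᗮ :=
    Submodule.topologicalClosure_minimal _
      (Submodule.span_le.2 fun g hg =>
        Submodule.mem_orthogonal_singleton_iff_inner_left.2 (hS g hg))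
      (Submodule.isClosed_orthogonal _)
  exact Submodule.mem_orthogonal_singleton_iff_inner_left.1 (hle hf)

theorem isClosed_Hplus : IsClosed (Hplus : Set L2R) :=
  Submodule.isClosed_topologicalClosure _

instance completeSpace_Hplus : CompleteSpace Hplus := isClosed_Hplus.completeSpace_coe

theorem conj_kernel (w : ℂ) (y : ℝ) :
    (starRingEnd ℂ) (I * y + (starRingEnd ℂ) w)⁻¹ = conjKernel w y := by
  simp [conjKernel, neg_add_eq_sub]

theorem conj_conjKernel (w : ℂ) (y : ℝ) :
    (starRingEnd ℂ) (conjKernel w y) = (I * y + (starRingEnd ℂ) w)⁻¹ := by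
  rw [← conj_kernel, Complex.conj_conj]

theorem Annihilated.congr {u v : ℝ → ℂ} (hu : Annihilated u) (h : u =ᵐ[volume] v) :
    Annihilated v where
  memLp := (memLp_congr_ae h).1 hu.memLp
  integral_eq_zero w hw := by
    rw [← hu.integral_eq_zero w hw]
    refine integral_congr_ae ?_
    filter_upwards [h] with y hy
    rw [hy]

theorem Annihilated.integral_conj_mul {u : ℝ → ℂ} (hu : Annihilated u) {h : L2R}
    (hh : h ∈ Hplus) : ∫ y : ℝ, (starRingEnd ℂ) (h y) * u y = 0 := by
  rw [← L2R_inner_toLp h hu.memLp]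
  refine inner_eq_zero_of_mem_closure_span ?_ hh
  rintro f ⟨w, hw, hf⟩
  rw [L2R_inner_toLp f hu.memLp, ← hu.integral_eq_zero w hw]
  refine integral_congr_ae ?_
  filter_upwards [hf] with y hy
  rw [hy, conj_kernel]

theorem annihilated_of_integral_conj_mul {u : ℝ → ℂ} (hu : MemLp u 2 volume)
    (h : ∀ h : L2R, h ∈ Hplus → ∫ y : ℝ, (starRingEnd ℂ) (h y) * u y = 0) : Annihilated u := by
  refine ⟨hu, fun w hw => ?_⟩
  have hk : MemLp (fun y => (starRingEnd ℂ) (conjKernel w y)) 2 volume := (memLp_conjKernel hw).star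
  have hmem : hk.toLp _ ∈ Hplus := by
    refine Submodule.le_topologicalClosure _ (Submodule.subset_span ⟨w, hw, ?_⟩)
    filter_upwards [hk.coeFn_toLp] with y hy
    rw [hy, conj_conjKernel]
  rw [← h _ hmem]
  refine integral_congr_ae ?_
  filter_upwards [hk.coeFn_toLp] with y hy
  rw [hy, Complex.conj_conj]

theorem mem_Hplus_of_annihilated {h : L2R}
    (H : ∀ u : ℝ → ℂ, Annihilated u → ∫ y : ℝ, (starRingEnd ℂ) (h y) * u y = 0) : h ∈ Hplus := by
  rw [← Submodule.orthogonal_orthogonal Hplus, Submodule.mem_orthogonal']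
  intro u hu
  rw [L2R_inner_eq]
  refine H u (annihilated_of_integral_conj_mul (Lp.memLp u) fun k hk => ?_)
  rw [← L2R_inner_eq]
  exact (Submodule.mem_orthogonal _ _).1 hu k hk

/-- The conjugate `(1 + iy)/(1 - iy)` of the Blaschke factor `(1 - s)/(1 + s)`. -/
def conjBlaschke (y : ℝ) : ℂ := 2 * conjKernel 1 y - 1

theorem conjKernel_one_mul (y : ℝ) : conjKernel 1 y * (1 - I * y) = 1 :=
  inv_mul_cancel₀ (sub_I_mul_ne_zero (by simp) y)

theorem one_add_I_mul_ne_zero (y : ℝ) : 1 + I * (y : ℂ) ≠ 0 := by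
  simpa using sub_I_mul_ne_zero (w := 1) (by simp) (-y)

theorem conjBlaschke_eq (y : ℝ) : conjBlaschke y = (1 + I * y) * conjKernel 1 y := by
  rw [conjBlaschke]
  linear_combination conjKernel_one_mul y

theorem memLp_conjBlaschke_pow_mul {u : ℝ → ℂ} (hu : MemLp u 2 volume) (k : ℕ) :
    MemLp (fun y => conjBlaschke y ^ k * u y) 2 volume := by
  induction k with
  | zero => simpa using hu
  | succ k ih =>
    refine (((memLp_conjKernel_mul ih (w := 1) (by simp)).const_mul 2).sub ih).ae_eq ?_
    refine Eventually.of_forall fun y => ?_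
    simp only [Pi.sub_apply, conjBlaschke]
    ring

theorem memLp_conjKernel_pow_mul {u : ℝ → ℂ} (hu : MemLp u 2 volume) (k : ℕ) :
    MemLp (fun y => conjKernel 1 y ^ k * u y) 2 volume := by
  induction k with
  | zero => simpa using hu
  | succ k ih =>
    simpa only [pow_succ', mul_assoc] using memLp_conjKernel_mul ih (w := 1) (by simp)

theorem Annihilated.conjBlaschke_pow_mul {u : ℝ → ℂ} (hu : Annihilated u) (k : ℕ) :
    Annihilated (fun y => conjBlaschke y ^ k * u y) := by
  induction k with
  | zero => simpa using hu
  | succ k ih =>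
    refine (((ih.conjKernel_mul (w := 1) (by simp)).const_mul 2).sub ih).congr ?_
    refine Eventually.of_forall fun y => ?_
    simp only [conjBlaschke]
    ring

theorem Annihilated.conjKernel_pow_mul {u : ℝ → ℂ} (hu : Annihilated u) (k : ℕ) :
    Annihilated (fun y => conjKernel 1 y ^ k * u y) := by
  induction k with
  | zero => simpa using hu
  | succ k ih => simpa only [pow_succ', mul_assoc] using ih.conjKernel_mul (w := 1) (by simp)

/-- The boundary values of `((1 - s)/(1 + s))^(n+1) e^{-δ s}`. -/
def modelSymbol (n : ℕ) (δ : ℝ) (y : ℝ) : ℂ :=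
  ((1 - I * y) / (1 + I * y)) ^ (n + 1) * exp (-(δ : ℂ) * (I * y))

theorem conj_exp_neg (a y : ℝ) : (starRingEnd ℂ) (exp (-(a : ℂ) * (I * y))) = phase a y := by
  rw [← Complex.exp_conj]
  simp [phase]

theorem conj_modelSymbol (n : ℕ) (δ y : ℝ) :
    (starRingEnd ℂ) (modelSymbol n δ y) = conjBlaschke y ^ (n + 1) * phase δ y := by
  rw [modelSymbol, map_mul, conj_exp_neg, map_pow, conjBlaschke_eq, conjKernel]
  simp [div_eq_mul_inv, sub_eq_add_neg]

theorem memLp_conj_modelSymbol_mul {u : ℝ → ℂ} (hu : MemLp u 2 volume) (n : ℕ) (δ : ℝ) :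
    MemLp (fun y => (starRingEnd ℂ) (modelSymbol n δ y) * u y) 2 volume := by
  simpa only [conj_modelSymbol, mul_assoc] using
    memLp_conjBlaschke_pow_mul (memLp_phase_mul hu δ) (n + 1)

theorem Annihilated.conj_modelSymbol_mul {u : ℝ → ℂ} (hu : Annihilated u) (n : ℕ) {δ : ℝ}
    (hδ : 0 ≤ δ) : Annihilated (fun y => (starRingEnd ℂ) (modelSymbol n δ y) * u y) := by
  simpa only [conj_modelSymbol, mul_assoc] using (hu.phase_mul hδ).conjBlaschke_pow_mul (n + 1)

theorem mem_KmodP_modelSymbol_iff (n : ℕ) (δ : ℝ) (f : L2R) :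
    f ∈ KmodP (modelSymbol n δ) ↔
      f ∈ Hplus ∧ Annihilated (fun y => (starRingEnd ℂ) (modelSymbol n δ y) * f y) := by
  have key : ∀ (h : L2R) (y : ℝ), (starRingEnd ℂ) (modelSymbol n δ y * h y) * f y
      = (starRingEnd ℂ) (h y) * ((starRingEnd ℂ) (modelSymbol n δ y) * f y) := fun h y => by
    rw [map_mul]
    ring
  simp only [KmodP, Set.mem_ofPred_eq, key]
  exact and_congr_right fun _ =>
    ⟨annihilated_of_integral_conj_mul (memLp_conj_modelSymbol_mul (Lp.memLp f) n δ),
      fun h _ hh => h.integral_conj_mul hh⟩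

theorem conj_generator (n : ℕ) (a y : ℝ) :
    (starRingEnd ℂ) (((1 + I * (y : ℂ)) ^ (n + 1))⁻¹ * exp (-(a : ℂ) * (I * y)))
      = phase a y * conjKernel 1 y ^ (n + 1) := by
  rw [map_mul, conj_exp_neg, conjKernel]
  simp [sub_eq_add_neg, mul_comm]

theorem generator_mem_KmodP {n : ℕ} {δ a : ℝ} (ha : 0 ≤ a) (haδ : a ≤ δ) {f : L2R}
    (hf : (f : ℝ → ℂ) =ᵐ[volume]
      fun y : ℝ => ((1 + I * (y : ℂ)) ^ (n + 1))⁻¹ * exp (-(a : ℂ) * (I * y))) :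
    f ∈ KmodP (modelSymbol n δ) := by
  rw [mem_KmodP_modelSymbol_iff]
  constructor
  · refine mem_Hplus_of_annihilated fun u hu => ?_
    rw [← ((hu.conjKernel_pow_mul n).phase_mul ha).integral_eq_zero 1 (by simp)]
    refine integral_congr_ae ?_
    filter_upwards [hf] with y hy
    rw [hy, conj_generator]
    ring
  · refine (((annihilated_conjKernel (v := 1) (by simp)).conjKernel_pow_mul n).phase_mul
      (sub_nonneg.2 haδ)).congr ?_
    filter_upwards [hf] with y hy
    have hp : phase δ y * exp (-(a : ℂ) * (I * y)) = phase (δ - a) y := by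
      rw [phase, phase, ← Complex.exp_add]
      push_cast
      ring_nf
    rw [hy, conj_modelSymbol, ← hp, conjBlaschke_eq, mul_pow]
    have := pow_ne_zero (n + 1) (one_add_I_mul_ne_zero y)
    field_simp
    ring

theorem NspanP_subset_KmodP (n : ℕ) (δ : ℝ) :
    NspanP δ (fun y : ℝ => ((1 + I * (y : ℂ)) ^ (n + 1))⁻¹) ⊆ KmodP (modelSymbol n δ) := by
  intro f hf
  rw [mem_KmodP_modelSymbol_iff]
  constructor
  · refine Submodule.topologicalClosure_minimal _ (Submodule.span_le.2 ?_) isClosed_Hplus hf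
    rintro g ⟨a, ha, haδ, hg⟩
    exact (generator_mem_KmodP ha haδ hg).1
  · have hmem := memLp_conj_modelSymbol_mul (Lp.memLp f) n δ
    refine annihilated_of_integral_conj_mul hmem fun h hh => ?_
    have hθh : MemLp (fun y => modelSymbol n δ y * h y) 2 volume := by
      have := (memLp_conj_modelSymbol_mul (Lp.memLp h).star n δ).star
      refine this.ae_eq (Eventually.of_forall fun y => ?_)
      simp
    have hinner : ∀ g : L2R, inner ℂ g (hθh.toLp _) = (starRingEnd ℂ)
        (∫ y : ℝ, (starRingEnd ℂ) (h y) * ((starRingEnd ℂ) (modelSymbol n δ y) * g y)) := by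
      intro g
      rw [L2R_inner_toLp, ← integral_conj]
      refine integral_congr_ae (Eventually.of_forall fun y => ?_)
      simp only [map_mul, Complex.conj_conj]
      ring
    have h0 : inner ℂ f (hθh.toLp _) = 0 := by
      refine inner_eq_zero_of_mem_closure_span ?_ hf
      rintro g ⟨a, ha, haδ, hg⟩
      rw [hinner, (((mem_KmodP_modelSymbol_iff n δ g).1
        (generator_mem_KmodP ha haδ hg)).2).integral_conj_mul hh, map_zero]
    rw [hinner] at h0
    simpa using h0

theorem bwdInvP_KmodP (n : ℕ) {δ : ℝ} (hδ : 0 ≤ δ) : BwdInvP (KmodP (modelSymbol n δ)) := by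
  intro t ht f hf
  have hf' := (mem_KmodP_modelSymbol_iff n δ f).1 hf
  have hF := memLp_phase_mul (Lp.memLp f) t
  set F : L2R := hF.toLp _
  set p : L2R := Hplus.starProjection F with hp
  have hpH : p ∈ Hplus := Submodule.starProjection_apply_mem _ _
  have hFcoe : (F : ℝ → ℂ) =ᵐ[volume] fun y => phase t y * f y := hF.coeFn_toLp
  have hann : Annihilated (fun y => phase t y * f y - p y) := by
    refine annihilated_of_integral_conj_mul (hF.sub (Lp.memLp p)) fun h hh => ?_
    have := (Submodule.mem_orthogonal _ _).1
      (Submodule.sub_starProjection_mem_orthogonal (K := Hplus) F) h hh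
    rw [L2R_inner_eq] at this
    rw [← this]
    refine integral_congr_ae ?_
    filter_upwards [hFcoe, Lp.coeFn_sub F p] with y h1 h2
    rw [← hp, h2, Pi.sub_apply, h1]
  refine ⟨p, (mem_KmodP_modelSymbol_iff n δ p).2 ⟨hpH, ?_⟩, fun h hh => hann.integral_conj_mul hh⟩
  refine ((hf'.2.phase_mul ht).sub (hann.conj_modelSymbol_mul n hδ)).congr
    (Eventually.of_forall fun y => ?_)
  simp only
  ring

/-- Differentiating in the translation parameter lowers the order of the pole. -/
theorem integral_phase_mul_conjKernel_pow_pred {u : ℝ → ℂ} (hu : MemLp u 2 volume) {δ : ℝ}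
    (hδ : 0 < δ) {k : ℕ}
    (h : ∀ t ∈ Set.Icc 0 δ, ∫ y, phase t y * (conjKernel 1 y ^ (k + 2) * u y) = 0) :
    ∀ t ∈ Set.Icc 0 δ, ∫ y, phase t y * (conjKernel 1 y ^ (k + 1) * u y) = 0 := by
  intro t ht
  have hint : ∀ j : ℕ, Integrable (fun y => conjKernel 1 y ^ (j + 1) * u y) := fun j => by
    simpa only [pow_succ', mul_assoc] using
      integrable_conjKernel_mul (memLp_conjKernel_pow_mul hu j) (w := 1) (by simp)
  have hderiv : ∀ y x : ℝ, HasDerivAt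
      (fun x => phase x y * (conjKernel 1 y ^ (k + 2) * u y))
      (phase x y * (conjKernel 1 y ^ (k + 2) * u y - conjKernel 1 y ^ (k + 1) * u y)) x := by
    intro y x
    have h1 : HasDerivAt (fun x : ℝ => (x : ℂ) * (I * y)) (I * y) x := by
      simpa using (Complex.ofRealCLM.hasDerivAt (x := x)).mul_const (I * (y : ℂ))
    refine (h1.cexp.mul_const (conjKernel 1 y ^ (k + 2) * u y)).congr_deriv ?_
    rw [phase]
    linear_combination (exp ((x : ℂ) * (I * y)) * conjKernel 1 y ^ (k + 1) * u y) *
      (-conjKernel_one_mul y)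
  have hdiff := (hint (k + 1)).sub (hint k)
  have hD := (hasDerivAt_integral_of_dominated_loc_of_deriv_le (x₀ := t) (s := Set.univ)
    (bound := fun y => ‖conjKernel 1 y ^ (k + 2) * u y - conjKernel 1 y ^ (k + 1) * u y‖)
    Filter.univ_mem (Eventually.of_forall fun x => (integrable_phase_mul (hint (k + 1)) x).1)
    (integrable_phase_mul (hint (k + 1)) t) (integrable_phase_mul hdiff t).1
    (Eventually.of_forall fun y x _ => by
      rw [norm_mul, norm_phase, one_mul])
    hdiff.norm (Eventually.of_forall fun y x _ => hderiv y x)).2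
  have h0 := ((uniqueDiffOn_Icc hδ) t ht).eq_deriv _ hD.hasDerivWithinAt
    ((hasDerivWithinAt_const t (Set.Icc 0 δ) (0 : ℂ)).congr h (h t ht))
  simp_rw [mul_sub] at h0
  rw [integral_sub (integrable_phase_mul (hint (k + 1)) t) (integrable_phase_mul (hint k) t),
    h t ht, zero_sub, neg_eq_zero] at h0
  exact h0

theorem integral_phase_mul_conjKernel_pow {u : ℝ → ℂ} (hu : MemLp u 2 volume) {δ : ℝ}
    (hδ : 0 < δ) {n : ℕ}
    (h : ∀ t ∈ Set.Icc 0 δ, ∫ y, phase t y * (conjKernel 1 y ^ (n + 1) * u y) = 0)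
    {k : ℕ} (hk : k ≤ n) :
    ∀ t ∈ Set.Icc 0 δ, ∫ y, phase t y * (conjKernel 1 y ^ (k + 1) * u y) = 0 :=
  Nat.decreasingInduction
    (motive := fun k _ => ∀ t ∈ Set.Icc 0 δ, ∫ y, phase t y * (conjKernel 1 y ^ (k + 1) * u y) = 0)
    (fun _ _ ih => integral_phase_mul_conjKernel_pow_pred hu hδ ih) h hk

theorem integral_conjBlaschke_pow_mul {v : ℝ → ℂ} (hv : MemLp v 2 volume) {n : ℕ}
    (h : ∀ k ≤ n, ∫ y, conjKernel 1 y ^ (k + 1) * v y = 0) (j : ℕ) :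
    ∀ k, j + k ≤ n → ∫ y, conjBlaschke y ^ j * (conjKernel 1 y ^ (k + 1) * v y) = 0 := by
  have hint : ∀ j k : ℕ,
      Integrable (fun y => conjBlaschke y ^ j * (conjKernel 1 y ^ (k + 1) * v y)) := fun j k => by
    refine (integrable_conjKernel_mul (memLp_conjBlaschke_pow_mul (memLp_conjKernel_pow_mul hv k) j)
      (w := 1) (by simp)).congr (Eventually.of_forall fun y => ?_)
    simp only
    ring
  induction j with
  | zero =>
    intro k hk
    simpa using h k (by omega)
  | succ j ih =>
    intro k hk
    have hrec : ∀ y, conjBlaschke y ^ (j + 1) * (conjKernel 1 y ^ (k + 1) * v y)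
        = 2 * (conjBlaschke y ^ j * (conjKernel 1 y ^ (k + 1 + 1) * v y))
          - conjBlaschke y ^ j * (conjKernel 1 y ^ (k + 1) * v y) := fun y => by
      rw [pow_succ (conjBlaschke y)]
      nth_rw 2 [conjBlaschke]
      ring
    simp_rw [hrec]
    rw [integral_sub ((hint j (k + 1)).const_mul 2) (hint j k), integral_const_mul,
      ih (k + 1) (by omega), ih k (by omega)]
    simp

theorem conjKernel_eq_conjBlaschke {w : ℂ} (hw : 0 < w.re) (y : ℝ) :
    conjKernel w y = (1 - w) / (1 + w) * (conjBlaschke y * conjKernel w y)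
      + 2 / (1 + w) * conjKernel 1 y := by
  have h1 : 1 - I * (y : ℂ) ≠ 0 := sub_I_mul_ne_zero (by simp) y
  have h2 := sub_I_mul_ne_zero hw y
  have h3 : 1 + w ≠ 0 := by
    intro h
    have := congrArg Complex.re h
    simp at this
    linarith
  rw [conjBlaschke_eq]
  unfold conjKernel
  field_simp
  ring

theorem annihilated_of_conjBlaschke_mul {v : ℝ → ℂ} (hv : MemLp v 2 volume)
    (hb : Annihilated fun y => conjBlaschke y * v y) (h : ∫ y, conjKernel 1 y * v y = 0) :
    Annihilated v where
  memLp := hv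
  integral_eq_zero w hw := by
    have hrec : ∀ y, conjKernel w y * v y
        = (1 - w) / (1 + w) * (conjKernel w y * (conjBlaschke y * v y))
          + 2 / (1 + w) * (conjKernel 1 y * v y) := fun y => by
      linear_combination v y * conjKernel_eq_conjBlaschke hw y
    simp_rw [hrec]
    rw [integral_add ((integrable_conjKernel_mul hb.memLp hw).const_mul _)
      ((integrable_conjKernel_mul hv (by simp)).const_mul _), integral_const_mul,
      integral_const_mul, hb.integral_eq_zero w hw, h]
    simp

theorem annihilated_of_conjBlaschke_pow_mul {v : ℝ → ℂ} (hv : MemLp v 2 volume) {n : ℕ}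
    (hb : Annihilated fun y => conjBlaschke y ^ (n + 1) * v y)
    (h : ∀ k ≤ n, ∫ y, conjKernel 1 y ^ (k + 1) * v y = 0) : Annihilated v := by
  have hj := Nat.decreasingInduction
    (motive := fun j _ => Annihilated fun y => conjBlaschke y ^ j * v y)
    (fun j hjn ih => by
      refine annihilated_of_conjBlaschke_mul (memLp_conjBlaschke_pow_mul hv j) ?_ ?_
      · simpa only [pow_succ', mul_assoc] using ih
      · have := integral_conjBlaschke_pow_mul hv h j 0 (by omega)
        simpa only [zero_add, pow_one, mul_left_comm] using this) hb (Nat.zero_le _)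
  simpa using hj

theorem annihilated_of_integral_phase_mul {f : ℝ → ℂ} (hf : MemLp f 2 volume)
    (h : ∀ t : ℝ, 0 ≤ t → ∫ y, phase t y * (conjKernel 1 y * f y) = 0) : Annihilated f where
  memLp := hf
  integral_eq_zero w hw := by
    have hint := integrable_conjKernel_mul hf (w := 1) (by simp)
    have h0 : ∫ y, conjKernel 1 y * f y = 0 := by simpa [phase_zero] using h 0 le_rfl
    by_cases hw1 : w = 1
    · rw [hw1, h0]
    have hL : ∫ y, conjKernel w y * (conjKernel 1 y * f y) = 0 := by
      rw [← laplace_integral_phase_mul hint hw,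
        setIntegral_congr_fun (g := fun _ => 0) measurableSet_Ioi]
      · simp
      · intro t ht
        simp [h t (le_of_lt ht)]
    have hrec : ∀ y, conjKernel w y * f y
        = conjKernel 1 y * f y - (w - 1) * (conjKernel w y * (conjKernel 1 y * f y)) := fun y => by
      have hne : (1 : ℂ) - w ≠ 0 := sub_ne_zero.2 fun h => hw1 h.symm
      have := conjKernel_mul_conjKernel hw (w := 1) (by simp) hw1 y
      field_simp at this
      linear_combination (-f y) * this
    simp_rw [hrec]
    rw [integral_sub hint
      ((integrable_conjKernel_mul (memLp_conjKernel_mul hf (by simp)) hw).const_mul _),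
      integral_const_mul, hL, h0]
    simp

theorem eq_zero_of_mem_KmodP {n : ℕ} {δ : ℝ} (hδ : 0 < δ) {f : L2R}
    (hf : f ∈ KmodP (modelSymbol n δ))
    (h : ∀ t ∈ Set.Icc 0 δ, ∫ y, phase t y * (conjKernel 1 y ^ (n + 1) * f y) = 0) : f = 0 := by
  obtain ⟨hfH, hfθ⟩ := (mem_KmodP_modelSymbol_iff n δ f).1 hf
  have hlow := fun k (hk : k ≤ n) => integral_phase_mul_conjKernel_pow (Lp.memLp f) hδ h hk
  have hδf : Annihilated fun y => phase δ y * f y := by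
    refine annihilated_of_conjBlaschke_pow_mul (n := n) (memLp_phase_mul (Lp.memLp f) δ) ?_ ?_
    · simpa only [conj_modelSymbol, mul_assoc] using hfθ
    · intro k hk
      simpa only [mul_left_comm] using hlow k hk δ (Set.right_mem_Icc.2 hδ.le)
  have hann : Annihilated f := by
    refine annihilated_of_integral_phase_mul (Lp.memLp f) fun t ht => ?_
    rcases le_total t δ with htδ | htδ
    · simpa using hlow 0 (Nat.zero_le n) t ⟨ht, htδ⟩
    · rw [← (hδf.phase_mul (sub_nonneg.2 htδ)).integral_eq_zero 1 (by simp)]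
      refine integral_congr_ae (Eventually.of_forall fun y => ?_)
      have := phase_add (t - δ) δ y
      rw [sub_add_cancel] at this
      simp only [this]
      ring
  rw [← inner_self_eq_zero (𝕜 := ℂ), L2R_inner_eq]
  exact hann.integral_conj_mul hfH

theorem KmodP_subset_NspanP (n : ℕ) {δ : ℝ} (hδ : 0 < δ) :
    KmodP (modelSymbol n δ) ⊆ NspanP δ (fun y : ℝ => ((1 + I * (y : ℂ)) ^ (n + 1))⁻¹) := by
  intro f hf
  set S : Set L2R := {f : L2R | ∃ lam : ℝ, 0 ≤ lam ∧ lam ≤ δ ∧ (f : ℝ → ℂ) =ᵐ[volume]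
    fun y : ℝ => ((1 + I * (y : ℂ)) ^ (n + 1))⁻¹ * exp (-(lam : ℂ) * (I * y))}
  set N : Submodule ℂ L2R := (Submodule.span ℂ S).topologicalClosure
  change f ∈ N
  have : CompleteSpace N := (Submodule.isClosed_topologicalClosure _).completeSpace_coe
  have hp : N.starProjection f ∈ N := Submodule.starProjection_apply_mem _ _
  have hpK := (mem_KmodP_modelSymbol_iff n δ _).1 (NspanP_subset_KmodP n δ hp)
  have hfK := (mem_KmodP_modelSymbol_iff n δ f).1 hf
  have hdiff : f - N.starProjection f ∈ KmodP (modelSymbol n δ) := by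
    refine (mem_KmodP_modelSymbol_iff n δ _).2 ⟨sub_mem hfK.1 hpK.1, (hfK.2.sub hpK.2).congr ?_⟩
    filter_upwards [Lp.coeFn_sub f (N.starProjection f)] with y hy
    rw [hy, Pi.sub_apply, mul_sub]
  have hzero : f - N.starProjection f = 0 := by
    refine eq_zero_of_mem_KmodP hδ hdiff fun t ht => ?_
    have hk : MemLp (fun y => (starRingEnd ℂ) (phase t y * (conjKernel 1 y ^ n * conjKernel 1 y)))
        2 volume :=
      (memLp_phase_mul (memLp_conjKernel_pow_mul (memLp_conjKernel (w := 1) (by simp)) n) t).star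
    have hmem : hk.toLp _ ∈ N := by
      refine Submodule.le_topologicalClosure _ (Submodule.subset_span ⟨t, ht.1, ht.2, ?_⟩)
      filter_upwards [hk.coeFn_toLp] with y hy
      rw [hy, ← pow_succ, ← conj_generator, Complex.conj_conj]
    have := (Submodule.mem_orthogonal _ _).1
      (Submodule.sub_starProjection_mem_orthogonal (K := N) f) _ hmem
    rw [L2R_inner_eq] at this
    rw [← this]
    refine integral_congr_ae ?_
    filter_upwards [hk.coeFn_toLp] with y hy
    rw [hy, Complex.conj_conj]
    ring
  rw [sub_eq_zero.1 hzero]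
  exact hp

/-- For every `n ∈ ℕ₀` and `δ > 0`, `N(1/(1+s)^(n+1))` is
backward-shift invariant and equals `K_θ`, `θ(s) = ((1-s)/(1+s))^(n+1) e^{-δ s}`. -/
theorem cyclic_stmt13 (n : ℕ) (δ : ℝ) (hδ : 0 < δ) :
    BwdInvP (NspanP δ fun y : ℝ => ((1 + Complex.I * y) ^ (n + 1))⁻¹) ∧
    NspanP δ (fun y : ℝ => ((1 + Complex.I * y) ^ (n + 1))⁻¹)
      = KmodP (fun y : ℝ => ((1 - Complex.I * y) / (1 + Complex.I * y)) ^ (n + 1) *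
          Complex.exp (-(δ : ℂ) * (Complex.I * y))) := by
  have heq := (NspanP_subset_KmodP n δ).antisymm (KmodP_subset_NspanP n hδ)
  refine ⟨?_, heq⟩
  rw [heq]
  exact bwdInvP_KmodP n hδ.le

end
end
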